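/- arXiv:0912.3381 — 2 statements merged into one kernel-verified Lean document; each statement's English description precedes it below -/
import Mathlib

section
/- Let (Y₁, ν₁, S₁) and (Y₂, ν₂, S₂) be two ergodic invertible measure-preserving systems. Let (X, μ) be the product probability space (Y₁ × Y₂, ν₁ × ν₂), and let T₁ = S₁ × id, T₂ = id × S₂. Let A ⊆ X be measurable with μ(A) > 0. Then for every ε > 0, the set {n ∈ ℤ : μ(A ∩ T₁ⁿA ∩ T₂ⁿA) > μ(A)³ − ε} is syndetic. -/
open MeasureTheory

/-- A set `E ⊆ ℤ` is syndetic if there is `N > 0` such that every interval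
`[M, M+N)` meets `E`. -/
def Syndetic (E : Set ℤ) : Prop :=
  ∃ N : ℤ, 0 < N ∧ ∀ M : ℤ, ∃ n ∈ E, M ≤ n ∧ n < M + N

open Filter Topology Set
open scoped TensorProduct

section Hilbert

variable {E : Type*} [NormedAddCommGroup E] [InnerProductSpace ℝ E]

/-- Averages along the orbit of a vector of a (not necessarily complete) inner product space under
a linear isometry form a Cauchy sequence. -/
theorem cauchySeq_average_isometry (f : E →ₗᵢ[ℝ] E) (x : E) :
    CauchySeq fun N : ℕ => (N : ℝ)⁻¹ • ∑ n ∈ Finset.range N, f^[n] x := by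
  let e : E →ₗᵢ[ℝ] UniformSpace.Completion E := UniformSpace.Completion.toComplₗᵢ
  have he : DenseRange e := UniformSpace.Completion.denseRange_coe
  have hb : ∀ y, ‖(e.toLinearMap ∘ₗ f.toLinearMap) y‖ ≤ 1 * ‖e.toLinearMap y‖ := by
    intro y; simp
  let F := (e.toLinearMap ∘ₗ f.toLinearMap).extendOfNorm e.toLinearMap
  have hF : ∀ y, F (e y) = e (f y) := fun y =>
    LinearMap.extendOfNorm_eq (f := e.toLinearMap ∘ₗ f.toLinearMap) (e := e.toLinearMap) he
      ⟨1, hb⟩ y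
  have hFn : ‖F‖ ≤ 1 := F.opNorm_le_bound zero_le_one
    (LinearMap.norm_extendOfNorm_apply_le he 1 hb)
  have hit : ∀ n : ℕ, F^[n] (e x) = e (f^[n] x) := by
    intro n
    induction n with
    | zero => rfl
    | succ n ih => rw [Function.iterate_succ_apply', ih, hF, Function.iterate_succ_apply']
  have h := (F.tendsto_birkhoffAverage_orthogonalProjection hFn (e x)).cauchySeq
  have heq : (fun N => birkhoffAverage ℝ F _root_.id N (e x)) =
      e ∘ fun N : ℕ => (N : ℝ)⁻¹ • ∑ n ∈ Finset.range N, f^[n] x := by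
    funext N
    simp [birkhoffAverage, birkhoffSum, hit, map_sum]
  rw [heq] at h
  exact e.isometry.isUniformInducing.cauchy_map_iff.1
    (by simpa only [CauchySeq, Filter.map_map] using h)

variable (U : E ≃ₗᵢ[ℝ] E)

theorem zpow_add_apply (m n : ℤ) (v : E) : (U ^ (m + n)) v = (U ^ m) ((U ^ n) v) := by
  rw [zpow_add]; rfl

theorem zpow_one_add_apply (n : ℤ) (v : E) : (U ^ (n + 1)) v = U ((U ^ n) v) := by
  rw [add_comm, zpow_add_apply, zpow_one]

theorem inner_zpow_zpow (n : ℤ) (v w : E) :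
    inner ℝ ((U ^ n) v) ((U ^ n) w) = inner ℝ v w :=
  (U ^ n).inner_map_map v w

theorem inner_zpow_left (n : ℤ) (v w : E) :
    inner ℝ ((U ^ n) v) w = inner ℝ v ((U ^ (-n)) w) := by
  rw [← inner_zpow_zpow U (-n), ← zpow_add_apply]; simp

theorem norm_zpow_apply (n : ℤ) (v : E) : ‖(U ^ n) v‖ = ‖v‖ := (U ^ n).norm_map v

/-- The average of the rank one operators attached to the first `N` vectors of an orbit. -/
noncomputable def orbitAverage (w : E) (N : ℕ) : E →L[ℝ] E :=
  (N : ℝ)⁻¹ • ∑ n ∈ Finset.range N, InnerProductSpace.rankOne ℝ ((U ^ (n : ℤ)) w) ((U ^ (n : ℤ)) w)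

theorem orbitAverage_apply (w : E) (N : ℕ) (u : E) :
    orbitAverage U w N u =
      (N : ℝ)⁻¹ • ∑ n ∈ Finset.range N, inner ℝ ((U ^ (n : ℤ)) w) u • (U ^ (n : ℤ)) w := by
  simp [orbitAverage]

theorem inner_orbitAverage (w : E) (N : ℕ) (u v : E) :
    inner ℝ (orbitAverage U w N u) v =
      (N : ℝ)⁻¹ * ∑ n ∈ Finset.range N,
        inner ℝ ((U ^ (n : ℤ)) w) u * inner ℝ ((U ^ (n : ℤ)) w) v := by
  simp [orbitAverage_apply, inner_smul_left, sum_inner]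

theorem isCompactOperator_orbitAverage (w : E) (N : ℕ) :
    IsCompactOperator (orbitAverage U w N) := by
  have h1 : ∀ x y : E, InnerProductSpace.rankOne ℝ x y ∈ compactOperator (RingHom.id ℝ) E E := by
    intro x y
    change IsCompactOperator _
    rw [InnerProductSpace.rankOne_def']
    have h : IsCompactOperator (ContinuousLinearMap.toSpanSingleton ℝ x) :=
      ⟨ContinuousLinearMap.toSpanSingleton ℝ x '' Metric.closedBall 0 1,
        (isCompact_closedBall 0 1).image (ContinuousLinearMap.continuous _),
        Filter.mem_of_superset (Metric.closedBall_mem_nhds 0 one_pos) (subset_preimage_image _ _)⟩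
    exact h.comp_clm (innerSL ℝ y)
  have h2 : orbitAverage U w N ∈ compactOperator (RingHom.id ℝ) E E :=
    Submodule.smul_mem _ _ (Submodule.sum_mem _ fun n _ => h1 _ _)
  exact h2

theorem cauchySeq_orbitAverage (w : E) : CauchySeq (orbitAverage U w) := by
  let V : (E ⊗[ℝ] E) →ₗᵢ[ℝ] (E ⊗[ℝ] E) :=
    TensorProduct.mapIsometry U.toLinearIsometry U.toLinearIsometry
  let t : ℕ → E ⊗[ℝ] E := fun N => (N : ℝ)⁻¹ • ∑ n ∈ Finset.range N, V^[n] (w ⊗ₜ w)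
  have ht : CauchySeq t := cauchySeq_average_isometry V (w ⊗ₜ w)
  have hit : ∀ n : ℕ, V^[n] (w ⊗ₜ w) = ((U ^ (n : ℤ)) w) ⊗ₜ ((U ^ (n : ℤ)) w) := by
    intro n
    induction n with
    | zero => simp
    | succ n ih =>
      rw [Function.iterate_succ_apply', ih]
      push_cast
      rw [zpow_one_add_apply]
      simp [V]
  have hinner : ∀ N u v, inner ℝ (orbitAverage U w N u) v = inner ℝ (t N) (u ⊗ₜ[ℝ] v) := by
    intro N u v
    simp only [t, hit, inner_orbitAverage]
    refine Eq.symm ((real_inner_smul_left (F := E ⊗[ℝ] E) _ _ _).trans ?_)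
    congr 1
    refine (sum_inner (𝕜 := ℝ) (E := E ⊗[ℝ] E) _ _ _).trans ?_
    exact Finset.sum_congr rfl fun n _ => TensorProduct.inner_tmul _ _ _ _ _
  have hdist : ∀ M N, ‖orbitAverage U w M - orbitAverage U w N‖ ≤ ‖t M - t N‖ := by
    intro M N
    refine ContinuousLinearMap.opNorm_le_bound _ (norm_nonneg _) fun u => ?_
    set z := (orbitAverage U w M - orbitAverage U w N) u with hz
    have h1 : ‖z‖ * ‖z‖ ≤ ‖t M - t N‖ * (‖u‖ * ‖z‖) := by
      rw [← real_inner_self_eq_norm_mul_norm, ← TensorProduct.norm_tmul (𝕜 := ℝ) u z]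
      refine le_trans (le_of_eq ?_) (real_inner_le_norm (t M - t N) (u ⊗ₜ[ℝ] z))
      rw [inner_sub_left, ← hinner, ← hinner, ← inner_sub_left]
      rfl
    rcases (norm_nonneg z).eq_or_lt with h0 | h0
    · rw [← h0]; positivity
    · exact le_of_mul_le_mul_right (by linarith) h0
  rw [Metric.cauchySeq_iff'] at ht ⊢
  intro ε hε
  obtain ⟨N, hN⟩ := ht ε hε
  refine ⟨N, fun n hn => ?_⟩
  have := hN n hn
  rw [dist_eq_norm] at this ⊢
  exact (hdist n N).trans_lt this

/-- A vector is almost periodic if its orbit is contained in a compact set. -/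
def AlmostPeriodic (v : E) : Prop := ∃ K : Set E, IsCompact K ∧ ∀ n : ℤ, (U ^ n) v ∈ K

variable {U} in
theorem AlmostPeriodic.zpow {v : E} (hv : AlmostPeriodic U v) (m : ℤ) :
    AlmostPeriodic U ((U ^ m) v) := by
  obtain ⟨K, hK, h⟩ := hv
  exact ⟨K, hK, fun n => by rw [← zpow_add_apply]; exact h _⟩

variable {U} in
theorem AlmostPeriodic.map {v : E} (hv : AlmostPeriodic U v) {f : E → E} (hf : Continuous f)
    (hfU : ∀ n : ℤ, ∀ u, (U ^ n) (f u) = f ((U ^ n) u)) : AlmostPeriodic U (f v) := by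
  obtain ⟨K, hK, h⟩ := hv
  exact ⟨f '' K, hK.image hf, fun n => by rw [hfU]; exact mem_image_of_mem _ (h n)⟩

/-- The subspace of almost periodic vectors. -/
def almostPeriodicSubmodule : Submodule ℝ E where
  carrier := {v | AlmostPeriodic U v}
  zero_mem' := ⟨{0}, isCompact_singleton, fun n => by simp⟩
  add_mem' := by
    rintro a b ⟨K, hK, ha⟩ ⟨L, hL, hb⟩
    exact ⟨_, (hK.prod hL).image continuous_add, fun n => by
      rw [map_add]; exact ⟨(_, _), ⟨ha n, hb n⟩, rfl⟩⟩
  smul_mem' := fun c v (hv : AlmostPeriodic U v) =>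
    hv.map (continuous_const_smul c) fun n u => map_smul _ _ _

variable [CompleteSpace E]

theorem isClosed_almostPeriodicSubmodule :
    IsClosed (almostPeriodicSubmodule U : Set E) := by
  refine isClosed_of_closure_subset fun v hv => ?_
  have htb : TotallyBounded (range fun n : ℤ => (U ^ n) v) := by
    rw [Metric.totallyBounded_iff]
    intro ε hε
    obtain ⟨w, ⟨K, hK, hw⟩, hvw⟩ := Metric.mem_closure_iff.1 hv (ε / 2) (half_pos hε)
    obtain ⟨t, ht, hKt⟩ := Metric.totallyBounded_iff.1 hK.totallyBounded (ε / 2) (half_pos hε)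
    refine ⟨t, ht, ?_⟩
    rintro _ ⟨n, rfl⟩
    obtain ⟨y, hy, hwy⟩ := mem_iUnion₂.1 (hKt (hw n))
    refine mem_iUnion₂.2 ⟨y, hy, ?_⟩
    rw [Metric.mem_ball] at hwy ⊢
    have h1 : dist ((U ^ n) v) ((U ^ n) w) = dist v w := (U ^ n).dist_map v w
    have h2 := dist_triangle ((U ^ n) v) ((U ^ n) w) y
    simp only
    linarith
  exact ⟨closure (range fun n : ℤ => (U ^ n) v), htb.closure.isCompact_of_isClosed isClosed_closure,
    fun n => subset_closure (mem_range_self n)⟩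

/-- The orbit averages of a vector orthogonal to all almost periodic vectors tend to zero in
operator norm. -/
theorem tendsto_orbitAverage {w : E} (hw : ∀ v, AlmostPeriodic U v → inner ℝ w v = 0) :
    Tendsto (orbitAverage U w) atTop (𝓝 0) := by
  obtain ⟨T, hT⟩ := cauchySeq_tendsto_of_complete (cauchySeq_orbitAverage U w)
  have hTc : IsCompactOperator T :=
    isCompactOperator_of_tendsto hT (Eventually.of_forall (isCompactOperator_orbitAverage U w))
  have happ : ∀ u, Tendsto (fun N => orbitAverage U w N u) atTop (𝓝 (T u)) := fun u =>
    ((ContinuousLinearMap.apply ℝ E u).continuous.tendsto T).comp hT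
  have hcomm : ∀ u, T (U u) = U (T u) := by
    intro u
    have h1 : Tendsto (fun N => orbitAverage U w N (U u) - U (orbitAverage U w N u)) atTop
        (𝓝 (T (U u) - U (T u))) :=
      (happ (U u)).sub ((U.continuous.tendsto _).comp (happ u))
    have h2 : Tendsto (fun N => orbitAverage U w N (U u) - U (orbitAverage U w N u)) atTop
        (𝓝 0) := by
      let g : ℕ → E := fun n => inner ℝ ((U ^ (n : ℤ)) w) (U u) • (U ^ (n : ℤ)) w
      have hg : ∀ n, ‖g n‖ ≤ ‖w‖ * ‖u‖ * ‖w‖ := by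
        intro n
        rw [norm_smul, norm_zpow_apply]
        gcongr
        refine (norm_inner_le_norm _ _).trans ?_
        rw [norm_zpow_apply, U.norm_map]
      have hdiff : ∀ N, orbitAverage U w N (U u) - U (orbitAverage U w N u) =
          (N : ℝ)⁻¹ • (g 0 - g N) := by
        intro N
        rw [← Finset.sum_range_sub', orbitAverage_apply, orbitAverage_apply, map_smul, ← smul_sub,
          map_sum, ← Finset.sum_sub_distrib]
        congr 1
        refine Finset.sum_congr rfl fun n _ => ?_
        simp only [g]
        push_cast
        rw [zpow_one_add_apply, U.inner_map_map, map_smul]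
      have hlim : Tendsto (fun N : ℕ => (N : ℝ)⁻¹ * (2 * (‖w‖ * ‖u‖ * ‖w‖))) atTop (𝓝 0) := by
        simpa using tendsto_inv_atTop_nhds_zero_nat.mul_const (2 * (‖w‖ * ‖u‖ * ‖w‖))
      refine squeeze_zero_norm (fun N => ?_) hlim
      rw [hdiff, norm_smul, norm_inv, Real.norm_natCast]
      gcongr
      refine (norm_sub_le _ _).trans ?_
      linarith [hg 0, hg N]
    exact sub_eq_zero.1 (tendsto_nhds_unique h1 h2)
  have hcomm_inv : ∀ u, T (U⁻¹ u) = U⁻¹ (T u) := by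
    intro u
    have h1 : U (T (U⁻¹ u)) = T u := by
      rw [← hcomm]; exact congrArg T (U.apply_symm_apply u)
    rw [← h1]; exact (U.symm_apply_apply _).symm
  have hcommz : ∀ n : ℤ, ∀ u, (U ^ n) (T u) = T ((U ^ n) u) := by
    intro n
    induction n using Int.induction_on with
    | zero => intro u; simp
    | succ n ih => intro u; rw [zpow_one_add_apply, zpow_one_add_apply, ih, hcomm]
    | pred n ih =>
      intro u
      rw [sub_eq_add_neg, add_comm, zpow_add_apply, zpow_add_apply, ih, zpow_neg_one, hcomm_inv]
  have hAP : ∀ u, AlmostPeriodic U (T u) := by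
    intro u
    obtain ⟨K, hK, h⟩ := hTc.image_closedBall_subset_compact (f := (T : E →ₗ[ℝ] E)) ‖u‖
    refine ⟨K, hK, fun n => h ?_⟩
    rw [hcommz]
    exact mem_image_of_mem _ (by simp)
  have hzero : ∀ u, T u = 0 := by
    intro u
    have h1 : Tendsto (fun N => inner ℝ (orbitAverage U w N u) (T u)) atTop
        (𝓝 (inner ℝ (T u) (T u))) := (happ u).inner tendsto_const_nhds
    have h2 : ∀ N, inner ℝ (orbitAverage U w N u) (T u) = 0 := by
      intro N
      rw [inner_orbitAverage, Finset.sum_eq_zero, mul_zero]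
      intro n _
      rw [inner_zpow_left U _ w (T u), hw _ ((hAP u).zpow _), mul_zero]
    simp only [h2] at h1
    exact inner_self_eq_zero.1 (tendsto_nhds_unique h1 tendsto_const_nhds)
  have : T = 0 := ContinuousLinearMap.ext hzero
  rwa [this] at hT

/-- A sequence is uniformly null if its absolute Cesàro means over intervals of length `N` tend to
zero uniformly in the position of the interval. -/
def UniformlyNull (c : ℤ → ℝ) : Prop :=
  ∀ η > 0, ∃ N₀ : ℕ, ∀ N ≥ N₀, ∀ M : ℤ, ∑ i ∈ Finset.range N, |c (M + i)| ≤ η * N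

omit [CompleteSpace E] in
theorem inner_orbitAverage_shift (w : E) (N : ℕ) (M : ℤ) (u : E) :
    inner ℝ (orbitAverage U w N ((U ^ (-M)) u)) ((U ^ (-M)) u) =
      (N : ℝ)⁻¹ * ∑ i ∈ Finset.range N, (inner ℝ ((U ^ (M + i)) w) u) ^ 2 := by
  rw [inner_orbitAverage]
  congr 1
  refine Finset.sum_congr rfl fun i _ => ?_
  rw [← inner_zpow_left, ← zpow_add_apply, sq]

theorem uniformlyNull_inner_zpow {w : E} (hw : ∀ v, AlmostPeriodic U v → inner ℝ w v = 0)
    (u : E) : UniformlyNull fun n => inner ℝ ((U ^ n) w) u := by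
  intro η hη
  have h0 : 0 < η ^ 2 / (1 + ‖u‖ * ‖u‖) := by positivity
  obtain ⟨N₀, hN₀⟩ := Metric.tendsto_atTop.1 (tendsto_orbitAverage U hw) _ h0
  refine ⟨N₀ + 1, fun N hN M => ?_⟩
  have hNpos : (0 : ℝ) < N := by exact_mod_cast (by omega : 0 < N)
  have h1 := hN₀ N (by omega)
  rw [dist_zero_right] at h1
  have h2 : (N : ℝ)⁻¹ * ∑ i ∈ Finset.range N, (inner ℝ ((U ^ (M + i)) w) u) ^ 2 ≤ η ^ 2 := by
    rw [← inner_orbitAverage_shift]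
    refine (real_inner_le_norm _ _).trans ?_
    calc _ ≤ (‖orbitAverage U w N‖ * ‖(U ^ (-M)) u‖) * ‖(U ^ (-M)) u‖ := by
          gcongr; exact ContinuousLinearMap.le_opNorm _ _
      _ = ‖orbitAverage U w N‖ * (‖u‖ * ‖u‖) := by rw [norm_zpow_apply, mul_assoc]
      _ ≤ η ^ 2 / (1 + ‖u‖ * ‖u‖) * (1 + ‖u‖ * ‖u‖) := by
          gcongr; linarith
      _ = η ^ 2 := by field_simp
  have h3 : ∑ i ∈ Finset.range N, (inner ℝ ((U ^ (M + i)) w) u) ^ 2 ≤ η ^ 2 * N := by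
    rwa [inv_mul_le_iff₀ hNpos, mul_comm] at h2
  calc ∑ i ∈ Finset.range N, |inner ℝ ((U ^ (M + i)) w) u|
      ≤ ∑ i ∈ Finset.range N, (η / 2 + (inner ℝ ((U ^ (M + i)) w) u) ^ 2 / (2 * η)) := by
        refine Finset.sum_le_sum fun i _ => ?_
        rw [← sub_nonneg, ← sq_abs]
        have : η / 2 + |inner ℝ ((U ^ (M + i)) w) u| ^ 2 / (2 * η) - |inner ℝ ((U ^ (M + i)) w) u|
          = (η - |inner ℝ ((U ^ (M + i)) w) u|) ^ 2 / (2 * η) := by field_simp; ring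
        rw [this]; positivity
    _ = N * (η / 2) + (∑ i ∈ Finset.range N, (inner ℝ ((U ^ (M + i)) w) u) ^ 2) / (2 * η) := by
        rw [Finset.sum_add_distrib, Finset.sum_div]; simp
    _ ≤ N * (η / 2) + (η ^ 2 * N) / (2 * η) := by gcongr
    _ = η * N := by field_simp; ring

end Hilbert

section Syndetic

theorem Syndetic.mono {A B : Set ℤ} (hA : Syndetic A) (h : A ⊆ B) : Syndetic B := by
  obtain ⟨N, hN, hM⟩ := hA
  refine ⟨N, hN, fun M => ?_⟩
  obtain ⟨n, hn, h1⟩ := hM M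
  exact ⟨n, h hn, h1⟩

theorem UniformlyNull.add {c d : ℤ → ℝ} (hc : UniformlyNull c) (hd : UniformlyNull d) :
    UniformlyNull fun n => c n + d n := by
  intro η hη
  obtain ⟨N₁, h₁⟩ := hc (η / 2) (half_pos hη)
  obtain ⟨N₂, h₂⟩ := hd (η / 2) (half_pos hη)
  refine ⟨max N₁ N₂, fun N hN M => ?_⟩
  have h1 := h₁ N (le_trans (le_max_left _ _) hN) M
  have h2 := h₂ N (le_trans (le_max_right _ _) hN) M
  calc _ ≤ ∑ i ∈ Finset.range N, (|c (M + i)| + |d (M + i)|) :=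
        Finset.sum_le_sum fun i _ => abs_add_le _ _
    _ ≤ η * N := by rw [Finset.sum_add_distrib]; linarith

theorem UniformlyNull.zero : UniformlyNull fun _ => 0 :=
  fun η hη => ⟨0, fun N _ M => by simp; positivity⟩

theorem UniformlyNull.sum {ι : Type*} (s : Finset ι) {c : ι → ℤ → ℝ}
    (hc : ∀ i ∈ s, UniformlyNull (c i)) : UniformlyNull fun n => ∑ i ∈ s, c i n := by
  classical
  induction s using Finset.induction_on with
  | empty => simpa using UniformlyNull.zero
  | insert a s ha ih =>
    simp only [Finset.sum_insert ha]
    exact (hc a (Finset.mem_insert_self _ _)).add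
      (ih fun i hi => hc i (Finset.mem_insert_of_mem hi))

theorem UniformlyNull.mul_bounded {c d : ℤ → ℝ} (hc : UniformlyNull c) {C : ℝ}
    (hd : ∀ n, |d n| ≤ C) : UniformlyNull fun n => c n * d n := by
  have hC : 0 ≤ C := (abs_nonneg _).trans (hd 0)
  intro η hη
  obtain ⟨N₁, h₁⟩ := hc (η / (C + 1)) (by positivity)
  refine ⟨N₁, fun N hN M => ?_⟩
  calc _ ≤ ∑ i ∈ Finset.range N, |c (M + i)| * (C + 1) := by
        refine Finset.sum_le_sum fun i _ => ?_
        rw [abs_mul]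
        gcongr
        linarith [hd (M + i)]
    _ ≤ η / (C + 1) * N * (C + 1) := by
        rw [← Finset.sum_mul]
        gcongr
        exact h₁ N hN M
    _ = η * N := by field_simp

theorem Syndetic.inter_uniformlyNull {R : Set ℤ} (hR : Syndetic R) {c : ℤ → ℝ}
    (hc : UniformlyNull c) {ε : ℝ} (hε : 0 < ε) : Syndetic {n | n ∈ R ∧ |c n| < ε} := by
  obtain ⟨L', hL, h⟩ := hR
  lift L' to ℕ using hL.le with L
  have hL0 : (0 : ℝ) < L := by exact_mod_cast hL
  obtain ⟨N₀, hN₀⟩ := hc (ε / (2 * L)) (by positivity)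
  have hLn : 1 ≤ L := by exact_mod_cast hL
  refine ⟨((N₀ + 1) * L : ℕ), by positivity, fun M => ?_⟩
  by_contra! hcon
  have key : ∀ k ≤ N₀ + 1, k * ε ≤ ∑ i ∈ Finset.range (k * L), |c (M + i)| := by
    intro k
    induction k with
    | zero => intro _; simp
    | succ k ih =>
      intro hk
      obtain ⟨n, hnR, hn1, hn2⟩ := h (M + (k * L : ℕ))
      obtain ⟨j, rfl⟩ : ∃ j : ℕ, n = M + (k * L : ℕ) + j :=
        ⟨(n - (M + (k * L : ℕ))).toNat, by omega⟩
      have hj : j < L := by omega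
      rw [Nat.succ_mul, Finset.sum_range_add]
      have h1 : ε ≤ |c (M + (k * L : ℕ) + j)| := by
        by_contra! hlt
        have h2 := hcon _ ⟨hnR, hlt⟩ (by omega)
        have h3 : (k + 1) * L ≤ (N₀ + 1) * L := Nat.mul_le_mul_right _ hk
        rw [Nat.succ_mul] at h3
        omega
      have h2 : |c (M + ((k * L + j : ℕ) : ℤ))| ≤
          ∑ x ∈ Finset.range L, |c (M + ((k * L + x : ℕ) : ℤ))| :=
        Finset.single_le_sum (f := fun x : ℕ => |c (M + ((k * L + x : ℕ) : ℤ))|)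
          (fun _ _ => abs_nonneg _) (Finset.mem_range.2 hj)
      have h3 : M + ((k * L + j : ℕ) : ℤ) = M + (k * L : ℕ) + j := by push_cast; ring
      rw [h3] at h2
      have := ih (by omega)
      push_cast at this ⊢
      push_cast at h1 h2
      linarith
  have h1 := key (N₀ + 1) le_rfl
  have h2 := hN₀ ((N₀ + 1) * L) (by nlinarith) M
  have h3 : ε / (2 * L) * ((N₀ + 1) * L : ℕ) = (N₀ + 1 : ℕ) * ε / 2 := by
    push_cast; field_simp
  have h4 : 0 < ((N₀ + 1 : ℕ) : ℝ) * ε := by positivity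
  linarith

/-- The return times of a precompact orbit of an isometric `ℤ`-action are syndetic. -/
theorem syndetic_return {Z : Type*} [PseudoMetricSpace Z] {z : ℤ → Z}
    (hz : ∀ k m n, dist (z (m + k)) (z (n + k)) = dist (z m) (z n))
    {K : Set Z} (hK : IsCompact K) (hzK : ∀ n, z n ∈ K) {δ : ℝ} (hδ : 0 < δ) :
    Syndetic {n | dist (z n) (z 0) < δ} := by
  have htb : TotallyBounded (range z) := hK.totallyBounded.subset (range_subset_iff.2 hzK)
  obtain ⟨t, ht, htfin, hcov⟩ :=
    totallyBounded_iff_subset.1 htb _ (Metric.dist_mem_uniformity hδ)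
  obtain ⟨s, hs⟩ := htfin.exists_finset_coe
  have hz_mem : ∀ y ∈ t, ∃ n, z n = y := fun y hy => ht hy
  choose! g hg using hz_mem
  obtain ⟨B, hB⟩ : ∃ B : ℕ, ∀ y ∈ s, |g y| ≤ B :=
    ⟨s.sup fun y => (g y).natAbs, fun y hy => by
      rw [Int.abs_eq_natAbs]
      exact_mod_cast Finset.le_sup (f := fun y => (g y).natAbs) hy⟩
  refine ⟨2 * B + 1, by positivity, fun M => ?_⟩
  obtain ⟨y, hy, hdist⟩ := mem_iUnion₂.1 (hcov (mem_range_self (M + B)))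
  have h1 := hB y (by rw [← Finset.mem_coe, hs]; exact hy)
  rw [abs_le] at h1
  refine ⟨M + B - g y, ?_, by omega, by omega⟩
  have h2 : dist (z (M + B)) y < δ := hdist
  have h3 := hz (g y) (M + B - g y) 0
  rw [sub_add_cancel, zero_add, hg y hy] at h3
  rw [mem_ofPred_eq, ← h3]
  exact h2

end Syndetic

section Koopman

variable {Y : Type*} [MeasurableSpace Y] {μ : Measure Y}

theorem measurePreserving_zpow {S : Y ≃ᵐ Y} (hS : MeasurePreserving S μ μ) (n : ℤ) :
    MeasurePreserving ⇑(S.toEquiv ^ n : Equiv.Perm Y) μ μ := by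
  induction n using Int.induction_on with
  | zero => exact MeasurePreserving.id μ
  | succ n ih =>
    rw [zpow_add_one]
    exact ih.comp hS
  | pred n ih =>
    rw [zpow_sub_one]
    exact ih.comp (hS.symm S)

/-- The Koopman operator `g ↦ g ∘ S⁻¹` on `L²`. -/
noncomputable def koopman {S : Y ≃ᵐ Y} (hS : MeasurePreserving S μ μ) :
    Lp ℝ 2 μ ≃ₗᵢ[ℝ] Lp ℝ 2 μ :=
  LinearIsometryEquiv.ofSurjective (Lp.compMeasurePreservingₗᵢ ℝ S.symm (hS.symm S)) fun g =>
    ⟨Lp.compMeasurePreserving S hS g, by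
      apply Lp.ext
      refine (Lp.coeFn_compMeasurePreserving _ (hS.symm S)).trans ?_
      refine ((hS.symm S).quasiMeasurePreserving.ae_eq_comp
        (Lp.coeFn_compMeasurePreserving g hS)).trans (Eventually.of_forall fun x => ?_)
      simp⟩

theorem coeFn_koopman {S : Y ≃ᵐ Y} (hS : MeasurePreserving S μ μ) (g : Lp ℝ 2 μ) :
    koopman hS g =ᵐ[μ] g ∘ S.symm :=
  Lp.coeFn_compMeasurePreserving g (hS.symm S)

theorem coeFn_koopman_inv {S : Y ≃ᵐ Y} (hS : MeasurePreserving S μ μ) (g : Lp ℝ 2 μ) :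
    ((koopman hS)⁻¹ : Lp ℝ 2 μ ≃ₗᵢ[ℝ] Lp ℝ 2 μ) g =ᵐ[μ] g ∘ S := by
  have h := coeFn_koopman hS ((koopman hS)⁻¹ g)
  have h1 : koopman hS ((koopman hS)⁻¹ g) = g := (koopman hS).apply_symm_apply g
  rw [h1] at h
  filter_upwards [hS.quasiMeasurePreserving.ae_eq_comp h] with x hx
  simpa using hx.symm

theorem coeFn_koopman_zpow {S : Y ≃ᵐ Y} (hS : MeasurePreserving S μ μ) (n : ℤ) (g : Lp ℝ 2 μ) :
    (koopman hS ^ n) g =ᵐ[μ] g ∘ ⇑(S.toEquiv ^ (-n) : Equiv.Perm Y) := by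
  induction n using Int.induction_on with
  | zero => exact Eventually.of_forall fun x => by simp
  | succ n ih =>
    rw [zpow_one_add_apply]
    refine (coeFn_koopman hS _).trans
      (((hS.symm S).quasiMeasurePreserving.ae_eq_comp ih).trans (Eventually.of_forall fun x => ?_))
    rw [neg_add, zpow_add, zpow_neg_one]
    rfl
  | pred n ih =>
    rw [sub_eq_add_neg, add_comm, zpow_add_apply, zpow_neg_one]
    refine (coeFn_koopman_inv hS _).trans
      ((hS.quasiMeasurePreserving.ae_eq_comp ih).trans (Eventually.of_forall fun x => ?_))
    rw [neg_add, neg_neg, neg_neg, add_comm, zpow_add, zpow_one]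
    rfl

theorem almostPeriodic_compLp {S : Y ≃ᵐ Y} (hS : MeasurePreserving S μ μ) {g : Lp ℝ 2 μ}
    (hg : AlmostPeriodic (koopman hS) g) {φ : ℝ → ℝ} {c : NNReal} (hφ : LipschitzWith c φ)
    (h0 : φ 0 = 0) : AlmostPeriodic (koopman hS) (hφ.compLp h0 g) := by
  refine hg.map (hφ.continuous_compLp h0) fun n u => ?_
  apply Lp.ext
  filter_upwards [coeFn_koopman_zpow hS n (hφ.compLp h0 u), coeFn_koopman_zpow hS n u,
    hφ.coeFn_compLp h0 ((koopman hS ^ n) u),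
    (measurePreserving_zpow hS (-n)).quasiMeasurePreserving.ae_eq_comp (hφ.coeFn_compLp h0 u)]
    with x h1 h2 h3 h4
  rw [h1, h3, h4]
  simp [h2]

theorem almostPeriodic_one [IsProbabilityMeasure μ] {S : Y ≃ᵐ Y} (hS : MeasurePreserving S μ μ) :
    AlmostPeriodic (koopman hS) (Lp.const 2 μ (1 : ℝ)) := by
  refine ⟨{Lp.const 2 μ (1 : ℝ)}, isCompact_singleton, fun n => ?_⟩
  apply Lp.ext
  filter_upwards [coeFn_koopman_zpow hS n (Lp.const 2 μ (1 : ℝ)),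
    Lp.coeFn_const (p := 2) (μ := μ) (1 : ℝ),
    (measurePreserving_zpow hS (-n)).quasiMeasurePreserving.ae_eq_comp
      (Lp.coeFn_const (p := 2) (μ := μ) (1 : ℝ))] with x h1 h2 h3
  rw [h1, h2, h3]
  rfl

/-- The orthogonal projection onto the almost periodic vectors. -/
noncomputable def almostPeriodicPart {S : Y ≃ᵐ Y} (hS : MeasurePreserving S μ μ) :
    Lp ℝ 2 μ →L[ℝ] Lp ℝ 2 μ :=
  have : CompleteSpace (almostPeriodicSubmodule (koopman hS)) :=
    (isClosed_almostPeriodicSubmodule (koopman hS)).completeSpace_coe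
  (almostPeriodicSubmodule (koopman hS)).starProjection

theorem almostPeriodic_almostPeriodicPart {S : Y ≃ᵐ Y} (hS : MeasurePreserving S μ μ)
    (g : Lp ℝ 2 μ) : AlmostPeriodic (koopman hS) (almostPeriodicPart hS g) := by
  have : CompleteSpace (almostPeriodicSubmodule (koopman hS)) :=
    (isClosed_almostPeriodicSubmodule (koopman hS)).completeSpace_coe
  exact (almostPeriodicSubmodule (koopman hS)).starProjection_apply_mem g

theorem inner_sub_almostPeriodicPart {S : Y ≃ᵐ Y} (hS : MeasurePreserving S μ μ)
    (g v : Lp ℝ 2 μ) (hv : AlmostPeriodic (koopman hS) v) :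
    inner ℝ (g - almostPeriodicPart hS g) v = 0 := by
  have : CompleteSpace (almostPeriodicSubmodule (koopman hS)) :=
    (isClosed_almostPeriodicSubmodule (koopman hS)).completeSpace_coe
  exact (almostPeriodicSubmodule (koopman hS)).starProjection_inner_eq_zero g v hv

theorem inner_almostPeriodicPart {S : Y ≃ᵐ Y} (hS : MeasurePreserving S μ μ)
    (g v : Lp ℝ 2 μ) (hv : AlmostPeriodic (koopman hS) v) :
    inner ℝ (almostPeriodicPart hS g) v = inner ℝ g v := by
  have := inner_sub_almostPeriodicPart hS g v hv
  rw [inner_sub_left] at this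
  linarith

theorem inner_Lp_eq_integral (g h : Lp ℝ 2 μ) : inner ℝ g h = ∫ x, g x * h x ∂μ := by
  rw [L2.inner_def]
  simp [mul_comm]

theorem almostPeriodicPart_nonneg {S : Y ≃ᵐ Y} (hS : MeasurePreserving S μ μ)
    {g : Lp ℝ 2 μ} (hg : ∀ᵐ x ∂μ, 0 ≤ g x) : ∀ᵐ x ∂μ, 0 ≤ almostPeriodicPart hS g x := by
  have hφ : LipschitzWith 1 fun t : ℝ => max (-t) 0 := LipschitzWith.id.neg.max_const 0
  have h0 : max (-(0 : ℝ)) 0 = 0 := by simp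
  set p := almostPeriodicPart hS g with hp
  have hAP := almostPeriodic_compLp hS (almostPeriodic_almostPeriodicPart hS g) hφ h0
  rw [← hp] at hAP
  set ψ := hφ.compLp h0 p with hψ
  have hψe : ψ =ᵐ[μ] fun x => max (-(p x)) 0 := hφ.coeFn_compLp h0 p
  have h1 : inner ℝ p ψ = inner ℝ g ψ := inner_almostPeriodicPart hS g ψ hAP
  have h2 : 0 ≤ inner ℝ g ψ := by
    rw [inner_Lp_eq_integral]
    refine integral_nonneg_of_ae ?_
    filter_upwards [hg, hψe] with x hx hx2
    rw [hx2]
    exact mul_nonneg hx (le_max_right _ _)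
  have h3 : inner ℝ p ψ = -inner ℝ ψ ψ := by
    rw [inner_Lp_eq_integral, inner_Lp_eq_integral, ← integral_neg]
    refine integral_congr_ae ?_
    filter_upwards [hψe] with x hx
    rw [hx]
    rcases le_total (p x) 0 with h | h
    · rw [max_eq_left (by linarith)]; ring
    · rw [max_eq_right (by linarith)]; ring
  have h4 : ψ = 0 := by
    have h5 : inner ℝ ψ ψ ≤ 0 := by linarith
    exact inner_self_eq_zero.1 (le_antisymm h5 real_inner_self_nonneg)
  filter_upwards [hψe, Lp.coeFn_zero ℝ 2 μ] with x hx hx2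
  rw [h4, hx2] at hx
  have := le_max_left (-(p x)) 0
  rw [← hx] at this
  simp only [Pi.zero_apply] at this
  linarith

theorem lipschitzWith_inv_max_add {δ : ℝ} (hδ : 0 < δ) :
    LipschitzWith (Real.toNNReal (δ⁻¹ * δ⁻¹)) fun t : ℝ => (max t 0 + δ)⁻¹ - δ⁻¹ := by
  refine LipschitzWith.of_dist_le_mul fun s t => ?_
  rw [Real.coe_toNNReal _ (by positivity), Real.dist_eq, Real.dist_eq]
  have hs : δ ≤ max s 0 + δ := by linarith [le_max_right s 0]
  have ht : δ ≤ max t 0 + δ := by linarith [le_max_right t 0]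
  have hs0 := hδ.trans_le hs
  have ht0 := hδ.trans_le ht
  have h1 : (max s 0 + δ)⁻¹ - δ⁻¹ - ((max t 0 + δ)⁻¹ - δ⁻¹) =
      ((max s 0 + δ)⁻¹ * (max t 0 + δ)⁻¹) * (max t 0 - max s 0) := by
    field_simp
    ring
  rw [h1, abs_mul, abs_of_nonneg (by positivity)]
  have h2 : |max t 0 - max s 0| ≤ |s - t| := by
    rw [abs_sub_comm s t]; exact abs_max_sub_max_le_abs t s 0
  have h3 := inv_anti₀ hδ hs
  have h4 := inv_anti₀ hδ ht
  gcongr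

theorem integrable_mul_inv_max_add {Ω : Type*} [MeasurableSpace Ω] {m : Measure Ω} {f e : Ω → ℝ}
    (hf : Integrable f m) (he : AEStronglyMeasurable e m) {δ : ℝ} (hδ : 0 < δ) :
    Integrable (fun x => f x * (max (e x) 0 + δ)⁻¹) m := by
  have hc : Continuous fun t : ℝ => (max t 0 + δ)⁻¹ :=
    Continuous.inv₀ (by fun_prop) fun t => by have := le_max_right t 0; positivity
  refine hf.mul_bdd (c := δ⁻¹) (hc.comp_aestronglyMeasurable he) (Eventually.of_forall fun x => ?_)
  have h1 : δ ≤ max (e x) 0 + δ := by linarith [le_max_right (e x) 0]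
  have h2 : 0 < max (e x) 0 + δ := hδ.trans_le h1
  rw [Real.norm_of_nonneg (by positivity)]
  exact inv_anti₀ hδ h1

theorem integral_mul_inv_almostPeriodicPart_le [IsProbabilityMeasure μ] {S : Y ≃ᵐ Y}
    (hS : MeasurePreserving S μ μ) (g : Lp ℝ 2 μ) {δ : ℝ} (hδ : 0 < δ) :
    ∫ x, g x * (max (almostPeriodicPart hS g x) 0 + δ)⁻¹ ∂μ ≤ 1 := by
  have hφ := lipschitzWith_inv_max_add hδ
  have h0 : (max (0 : ℝ) 0 + δ)⁻¹ - δ⁻¹ = 0 := by simp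
  set p := almostPeriodicPart hS g with hp
  have hAP := almostPeriodic_compLp hS (almostPeriodic_almostPeriodicPart hS g) hφ h0
  rw [← hp] at hAP
  set ψ := hφ.compLp h0 p with hψ
  have hψe : ψ =ᵐ[μ] fun x => (max (p x) 0 + δ)⁻¹ - δ⁻¹ := hφ.coeFn_compLp h0 p
  have hv : AlmostPeriodic (koopman hS) (ψ + δ⁻¹ • Lp.const 2 μ (1 : ℝ)) :=
    (almostPeriodicSubmodule (koopman hS)).add_mem hAP
      ((almostPeriodicSubmodule (koopman hS)).smul_mem _ (almostPeriodic_one hS))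
  set v := ψ + δ⁻¹ • Lp.const 2 μ (1 : ℝ) with hvdef
  have hve : v =ᵐ[μ] fun x => (max (p x) 0 + δ)⁻¹ := by
    filter_upwards [hψe, Lp.coeFn_add ψ (δ⁻¹ • Lp.const 2 μ (1 : ℝ)),
      Lp.coeFn_smul δ⁻¹ (Lp.const 2 μ (1 : ℝ)), Lp.coeFn_const (p := 2) (μ := μ) (1 : ℝ)]
      with x h1 h2 h3 h4
    rw [h2, Pi.add_apply, h1, h3, Pi.smul_apply, h4]
    simp
  have h1 := inner_almostPeriodicPart hS g v hv
  rw [inner_Lp_eq_integral, inner_Lp_eq_integral] at h1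
  have h2 : ∫ x, g x * (max (p x) 0 + δ)⁻¹ ∂μ = ∫ x, p x * (max (p x) 0 + δ)⁻¹ ∂μ := by
    rw [integral_congr_ae (g := fun x => g x * v x), ← h1]
    · refine integral_congr_ae ?_
      filter_upwards [hve] with x hx
      rw [hx]
    · filter_upwards [hve] with x hx
      rw [hx]
  rw [h2]
  have h3 : ∫ x, p x * (max (p x) 0 + δ)⁻¹ ∂μ ≤ ∫ _, (1 : ℝ) ∂μ := by
    refine integral_mono (integrable_mul_inv_max_add ((Lp.memLp p).integrable one_le_two)
      (Lp.aestronglyMeasurable p) hδ) (integrable_const _) fun x => ?_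
    have h4 : 0 < max (p x) 0 + δ := by linarith [le_max_right (p x) 0]
    have h5 := le_max_left (p x) 0
    change p x * (max (p x) 0 + δ)⁻¹ ≤ 1
    rw [← div_eq_mul_inv, div_le_one h4]
    linarith
  simpa using h3

end Koopman

section Correlations

variable {E₁ E₂ : Type*} [NormedAddCommGroup E₁] [InnerProductSpace ℝ E₁] [CompleteSpace E₁]
  [NormedAddCommGroup E₂] [InnerProductSpace ℝ E₂] [CompleteSpace E₂]

theorem abs_inner_zpow_le {E : Type*} [NormedAddCommGroup E] [InnerProductSpace ℝ E]
    (U : E ≃ₗᵢ[ℝ] E) (n : ℤ) (v u : E) : |inner ℝ ((U ^ n) v) u| ≤ ‖v‖ * ‖u‖ := by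
  have := abs_real_inner_le_norm ((U ^ n) v) u
  rwa [norm_zpow_apply] at this

/-- Finite sums of products of correlations return, along a syndetic set, to the value at time
zero computed with the almost periodic parts. -/
theorem syndetic_sum_inner_mul_inner (U₁ : E₁ ≃ₗᵢ[ℝ] E₁) (U₂ : E₂ ≃ₗᵢ[ℝ] E₂)
    {J : Type*} [Fintype J] (α p u : J → E₁) (β q v : J → E₂)
    (hp : ∀ j, AlmostPeriodic U₁ (p j)) (hq : ∀ j, AlmostPeriodic U₂ (q j))
    (hα : ∀ j x, AlmostPeriodic U₁ x → inner ℝ (α j - p j) x = 0)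
    (hβ : ∀ j x, AlmostPeriodic U₂ x → inner ℝ (β j - q j) x = 0) {ε : ℝ} (hε : 0 < ε) :
    Syndetic {n : ℤ | |∑ j, inner ℝ ((U₁ ^ n) (α j)) (u j) * inner ℝ ((U₂ ^ n) (β j)) (v j) -
      ∑ j, inner ℝ (p j) (u j) * inner ℝ (q j) (v j)| < ε} := by
  let Φ : (J → E₁ × E₂) → ℝ := fun z => ∑ j, inner ℝ (z j).1 (u j) * inner ℝ (z j).2 (v j)
  have hΦ : Continuous Φ := by fun_prop
  let z : ℤ → J → E₁ × E₂ := fun n j => ((U₁ ^ n) (p j), (U₂ ^ n) (q j))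
  have hz : ∀ k m n, dist (z (m + k)) (z (n + k)) = dist (z m) (z n) := by
    intro k m n
    rw [dist_pi_def, dist_pi_def]
    congr 2
    funext j
    apply NNReal.eq
    change dist _ _ = dist _ _
    simp only [z, Prod.dist_eq]
    rw [add_comm m k, add_comm n k]
    simp only [zpow_add_apply, LinearIsometryEquiv.dist_map]
  choose K hK hKp using hp
  choose L hL hLq using hq
  obtain ⟨δ, hδ, hδΦ⟩ := Metric.continuousAt_iff.1
    (hΦ.continuousAt (x := z 0)) (ε / 2) (half_pos hε)
  have hR := syndetic_return hz (isCompact_univ_pi fun j => (hK j).prod (hL j))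
    (fun n j _ => ⟨hKp j n, hLq j n⟩) hδ
  have hnull : UniformlyNull fun n => ∑ j,
      (inner ℝ ((U₁ ^ n) (α j - p j)) (u j) * inner ℝ ((U₂ ^ n) (β j)) (v j) +
        inner ℝ ((U₂ ^ n) (β j - q j)) (v j) * inner ℝ ((U₁ ^ n) (p j)) (u j)) :=
    UniformlyNull.sum _ fun j _ =>
      ((uniformlyNull_inner_zpow U₁ (hα j) (u j)).mul_bounded fun n =>
        abs_inner_zpow_le U₂ n (β j) (v j)).add
      ((uniformlyNull_inner_zpow U₂ (hβ j) (v j)).mul_bounded fun n =>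
        abs_inner_zpow_le U₁ n (p j) (u j))
  refine (hR.inter_uniformlyNull hnull (half_pos hε)).mono fun n hn => ?_
  obtain ⟨h1, h2⟩ := hn
  have h3 := hδΦ h1
  rw [Real.dist_eq] at h3
  have h4 : Φ (z 0) = ∑ j, inner ℝ (p j) (u j) * inner ℝ (q j) (v j) := by simp [Φ, z]
  rw [h4] at h3
  have h5 : ∑ j, inner ℝ ((U₁ ^ n) (α j)) (u j) * inner ℝ ((U₂ ^ n) (β j)) (v j) -
      ∑ j, inner ℝ (p j) (u j) * inner ℝ (q j) (v j) =
      (∑ j, (inner ℝ ((U₁ ^ n) (α j - p j)) (u j) * inner ℝ ((U₂ ^ n) (β j)) (v j) +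
        inner ℝ ((U₂ ^ n) (β j - q j)) (v j) * inner ℝ ((U₁ ^ n) (p j)) (u j))) +
      (Φ (z n) - ∑ j, inner ℝ (p j) (u j) * inner ℝ (q j) (v j)) := by
    rw [← add_sub_assoc, ← Finset.sum_add_distrib]
    congr 1
    refine Finset.sum_congr rfl fun j _ => ?_
    simp only [z, map_sub, inner_sub_left]
    ring
  rw [mem_ofPred_eq, h5]
  refine (abs_add_le _ _).trans_lt ?_
  linarith

end Correlations

theorem three_mul_sq_le_mul_add {a b c : ℝ} (ha : 0 < a) (hb : 0 < b) (hc : 0 ≤ c) :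
    3 * c ^ 2 - c ^ 3 * a⁻¹ - c ^ 3 * b⁻¹ ≤ a * b := by
  obtain ⟨s, hs, hsab⟩ : ∃ s : ℝ, 0 < s ∧ s ^ 2 = a * b :=
    ⟨√(a * b), by positivity, Real.sq_sqrt (by positivity)⟩
  have h1 : 2 * s ≤ a + b := by
    refine abs_le_of_sq_le_sq' ?_ (by positivity) |>.2
    nlinarith [sq_nonneg (a - b)]
  have h2 : 3 * c ^ 2 * s ^ 2 ≤ s ^ 2 * s ^ 2 + c ^ 3 * (a + b) := by
    have h3 : 0 ≤ s * (s - c) ^ 2 * (s + 2 * c) := by positivity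
    have h4 : c ^ 3 * (2 * s) ≤ c ^ 3 * (a + b) := by gcongr
    nlinarith
  have h5 : c ^ 3 * a⁻¹ + c ^ 3 * b⁻¹ = c ^ 3 * (a + b) / s ^ 2 := by
    rw [hsab]; field_simp; ring
  have h6 : 3 * c ^ 2 ≤ s ^ 2 + c ^ 3 * (a + b) / s ^ 2 := by
    have h7 : s ^ 2 + c ^ 3 * (a + b) / s ^ 2 = (s ^ 2 * s ^ 2 + c ^ 3 * (a + b)) / s ^ 2 := by
      field_simp
    rw [h7, le_div_iff₀ (by positivity)]
    exact h2
  linarith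

/-- A lower bound for a triple integral in terms of functions `e₁`, `e₂` that dominate `f` in the
sense that `∫ f / eᵢ ≤ 1`. -/
theorem integral_pow_three_le {Ω : Type*} [MeasurableSpace Ω] {m : Measure Ω}
    {f e₁ e₂ : Ω → ℝ} (hf : Integrable f m) (hf0 : ∀ x, 0 ≤ f x)
    (he₁ : AEStronglyMeasurable e₁ m) (he₂ : AEStronglyMeasurable e₂ m)
    (h₁ : ∀ᵐ x ∂m, 0 ≤ e₁ x) (h₂ : ∀ᵐ x ∂m, 0 ≤ e₂ x)
    (hi₁ : Integrable (fun x => f x * e₁ x) m) (hi₂ : Integrable (fun x => f x * e₂ x) m)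
    (hi : Integrable (fun x => f x * e₁ x * e₂ x) m)
    (hb₁ : ∀ δ > 0, ∫ x, f x * (max (e₁ x) 0 + δ)⁻¹ ∂m ≤ 1)
    (hb₂ : ∀ δ > 0, ∫ x, f x * (max (e₂ x) 0 + δ)⁻¹ ∂m ≤ 1) :
    (∫ x, f x ∂m) ^ 3 ≤ ∫ x, f x * e₁ x * e₂ x ∂m := by
  set c := ∫ x, f x ∂m with hc
  have hc0 : 0 ≤ c := integral_nonneg hf0
  set I := ∫ x, f x * e₁ x * e₂ x ∂m with hI
  set C := (∫ x, f x * e₁ x ∂m) + ∫ x, f x * e₂ x ∂m with hC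
  have key : ∀ δ > 0, c ^ 3 ≤ I + δ * C + δ ^ 2 * c := by
    intro δ hδ
    have hj₁ := integrable_mul_inv_max_add hf he₁ hδ
    have hj₂ := integrable_mul_inv_max_add hf he₂ hδ
    have hle : ∫ x, (3 * c ^ 2 * f x - c ^ 3 * (f x * (max (e₁ x) 0 + δ)⁻¹)
        - c ^ 3 * (f x * (max (e₂ x) 0 + δ)⁻¹)) ∂m ≤
        ∫ x, (f x * e₁ x * e₂ x + δ * (f x * e₁ x + f x * e₂ x) + δ ^ 2 * f x) ∂m := by
      refine integral_mono_ae
        (((hf.const_mul _).sub (hj₁.const_mul _)).sub (hj₂.const_mul _))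
        ((hi.add ((hi₁.add hi₂).const_mul _)).add (hf.const_mul _)) ?_
      filter_upwards [h₁, h₂] with x hx₁ hx₂
      have h3 : 0 < max (e₁ x) 0 + δ := by linarith [le_max_right (e₁ x) 0]
      have h4 : 0 < max (e₂ x) 0 + δ := by linarith [le_max_right (e₂ x) 0]
      have h5 := mul_le_mul_of_nonneg_left (three_mul_sq_le_mul_add h3 h4 hc0) (hf0 x)
      have h6 : f x * ((max (e₁ x) 0 + δ) * (max (e₂ x) 0 + δ)) =
          f x * e₁ x * e₂ x + δ * (f x * e₁ x + f x * e₂ x) + δ ^ 2 * f x := by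
        rw [max_eq_left hx₁, max_eq_left hx₂]; ring
      rw [h6] at h5
      linarith
    have hA : Integrable (fun x => 3 * c ^ 2 * f x - c ^ 3 * (f x * (max (e₁ x) 0 + δ)⁻¹)) m :=
      (hf.const_mul _).sub (hj₁.const_mul _)
    have hB : Integrable (fun x => δ * (f x * e₁ x + f x * e₂ x)) m :=
      (hi₁.add hi₂).const_mul _
    have hD : Integrable (fun x => f x * e₁ x * e₂ x + δ * (f x * e₁ x + f x * e₂ x)) m :=
      hi.add hB
    rw [integral_sub hA (hj₂.const_mul _), integral_sub (hf.const_mul _) (hj₁.const_mul _),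
      integral_const_mul, integral_const_mul, integral_const_mul,
      integral_add hD (hf.const_mul _), integral_add hi hB, integral_const_mul,
      integral_const_mul, integral_add hi₁ hi₂, ← hc, ← hI, ← hC] at hle
    have h7 := mul_le_mul_of_nonneg_left (hb₁ δ hδ) (pow_nonneg hc0 3)
    have h8 := mul_le_mul_of_nonneg_left (hb₂ δ hδ) (pow_nonneg hc0 3)
    nlinarith
  have hlim : Tendsto (fun δ : ℝ => I + δ * C + δ ^ 2 * c) (𝓝[>] 0) (𝓝 I) := by
    have : Continuous fun δ : ℝ => I + δ * C + δ ^ 2 * c := by fun_prop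
    simpa using (this.tendsto 0).mono_left nhdsWithin_le_nhds
  exact ge_of_tendsto hlim (eventually_mem_nhdsWithin.mono fun δ hδ => key δ hδ)

section FiniteSums

variable {Y : Type*} [MeasurableSpace Y] {ν : Measure Y}

theorem coeFn_sum_smul {ι : Type*} (s : Finset ι) (c : ι → ℝ) (g : ι → Lp ℝ 2 ν) :
    (∑ i ∈ s, c i • g i : Lp ℝ 2 ν) =ᵐ[ν] fun y => ∑ i ∈ s, c i * g i y := by
  classical
  induction s using Finset.induction_on with
  | empty =>
    simp only [Finset.sum_empty]
    exact Lp.coeFn_zero ℝ 2 ν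
  | insert a s ha ih =>
    rw [Finset.sum_insert ha]
    filter_upwards [Lp.coeFn_add (c a • g a) (∑ i ∈ s, c i • g i), Lp.coeFn_smul (c a) (g a), ih]
      with y h1 h2 h3
    rw [h1, Pi.add_apply, h2, h3, Finset.sum_insert ha]
    rfl

theorem sum_mul_almostPeriodicPart_ae_eq {S : Y ≃ᵐ Y} (hS : MeasurePreserving S ν ν)
    {X ι : Type*} [Fintype ι] {a : ι → X → ℝ} {b : ι → Y → ℝ} (hb : ∀ i, MemLp (b i) 2 ν) (x : X) :
    ∃ g : Lp ℝ 2 ν, g =ᵐ[ν] (fun y => ∑ i, a i x * b i y) ∧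
      almostPeriodicPart hS g =ᵐ[ν]
        fun y => ∑ i, a i x * almostPeriodicPart hS ((hb i).toLp) y := by
  refine ⟨∑ i, a i x • (hb i).toLp, ?_, ?_⟩
  · filter_upwards [coeFn_sum_smul Finset.univ (fun i => a i x) (fun i => (hb i).toLp),
      eventually_all.2 fun i => (hb i).coeFn_toLp] with y h1 h2
    rw [h1]
    exact Finset.sum_congr rfl fun i _ => by rw [h2 i]
  · rw [map_sum]
    simp only [map_smul]
    exact coeFn_sum_smul _ _ _

end FiniteSums

section Product

variable {X Y : Type*} [MeasurableSpace X] [MeasurableSpace Y] {μ : Measure X} {ν : Measure Y}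

variable {ι : Type*} [Fintype ι] {a : ι → X → ℝ} {b : ι → Y → ℝ}

theorem measurable_sum_mul (ha : ∀ i, Measurable (a i)) (hb : ∀ i, Measurable (b i)) :
    Measurable fun z : X × Y => ∑ i, a i z.1 * b i z.2 :=
  Finset.measurable_fun_sum _ fun i _ =>
    ((ha i).comp measurable_fst).mul ((hb i).comp measurable_snd)

theorem measurable_coeFn_Lp (g : Lp ℝ 2 ν) : Measurable g := (Lp.stronglyMeasurable g).measurable

variable [IsProbabilityMeasure ν] {S : Y ≃ᵐ Y} (hS : MeasurePreserving S ν ν)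

theorem sum_mul_almostPeriodicPart_nonneg [SFinite μ] (ha : ∀ i, Measurable (a i))
    (hb : ∀ i, MemLp (b i) 2 ν) (h0 : ∀ x y, 0 ≤ ∑ i, a i x * b i y) :
    ∀ᵐ z ∂μ.prod ν, 0 ≤ ∑ i, a i z.1 * almostPeriodicPart hS ((hb i).toLp) z.2 := by
  have hm : MeasurableSet {z : X × Y | 0 ≤ ∑ i, a i z.1 *
      almostPeriodicPart hS ((hb i).toLp) z.2} :=
    measurableSet_le measurable_const (measurable_sum_mul ha fun i => measurable_coeFn_Lp _)
  refine (Measure.ae_prod_iff_ae_ae hm).2 (Eventually.of_forall fun x => ?_)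
  obtain ⟨g, hg, hpg⟩ := sum_mul_almostPeriodicPart_ae_eq (a := a) hS hb x
  have := almostPeriodicPart_nonneg hS (g := g) (hg.mono fun y hy => by rw [hy]; exact h0 x y)
  filter_upwards [this, hpg] with y h1 h2
  rwa [h2] at h1

theorem integral_sum_mul_inv_le [IsProbabilityMeasure μ] (ha : ∀ i, Measurable (a i))
    (hbm : ∀ i, Measurable (b i)) (hb : ∀ i, MemLp (b i) 2 ν)
    (h0 : ∀ x y, 0 ≤ ∑ i, a i x * b i y) (h1 : ∀ x y, ∑ i, a i x * b i y ≤ 1)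
    {δ : ℝ} (hδ : 0 < δ) :
    ∫ z, (∑ i, a i z.1 * b i z.2) *
      (max (∑ i, a i z.1 * almostPeriodicPart hS ((hb i).toLp) z.2) 0 + δ)⁻¹ ∂μ.prod ν ≤ 1 := by
  have hf : Integrable (fun z : X × Y => ∑ i, a i z.1 * b i z.2) (μ.prod ν) :=
    Integrable.of_bound (measurable_sum_mul ha hbm).aestronglyMeasurable 1
      (Eventually.of_forall fun z => by
        rw [Real.norm_of_nonneg (h0 _ _)]; exact h1 _ _)
  have hi := integrable_mul_inv_max_add hf
    (measurable_sum_mul ha fun i => measurable_coeFn_Lp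
      (almostPeriodicPart hS ((hb i).toLp))).aestronglyMeasurable hδ
  rw [integral_prod _ hi]
  have hle : ∫ x, (∫ y, (∑ i, a i x * b i y) *
      (max (∑ i, a i x * almostPeriodicPart hS ((hb i).toLp) y) 0 + δ)⁻¹ ∂ν) ∂μ ≤
      ∫ _, (1 : ℝ) ∂μ := by
    refine integral_mono hi.integral_prod_left (integrable_const _) fun x => ?_
    obtain ⟨g, hg, hpg⟩ := sum_mul_almostPeriodicPart_ae_eq (a := a) hS hb x
    refine le_trans (le_of_eq ?_) (integral_mul_inv_almostPeriodicPart_le hS g hδ)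
    refine integral_congr_ae ?_
    filter_upwards [hg, hpg] with y h2 h3
    rw [h2, h3]
  simpa using hle

end Product

section Triple

theorem triple_product_eq_sum {X Y ι : Type*} [Fintype ι] {a : ι → X → ℝ} {b : ι → Y → ℝ}
    (P : ι → X → ℝ) (Q : ι → Y → ℝ) (z : X × Y) :
    (∑ i, a i z.1 * b i z.2) * (∑ i, P i z.1 * b i z.2) * (∑ i, a i z.1 * Q i z.2) =
      ∑ t : ι × ι × ι, (P t.2.1 z.1 * (a t.1 z.1 * a t.2.2 z.1)) *
        (Q t.2.2 z.2 * (b t.1 z.2 * b t.2.1 z.2)) := by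
  simp only [Fintype.sum_prod_type, Finset.sum_mul_sum]
  rw [Finset.sum_comm]
  simp only [Finset.sum_mul]
  rw [Finset.sum_comm]
  refine Finset.sum_congr rfl fun i _ => ?_
  rw [Finset.sum_comm]
  refine Finset.sum_congr rfl fun j _ => Finset.sum_congr rfl fun k _ => by ring

variable {X Y : Type*} [MeasurableSpace X] [MeasurableSpace Y] {μ : Measure X} {ν : Measure Y}

theorem integrable_mul_of_abs_le_one {Ω : Type*} [MeasurableSpace Ω] {m : Measure Ω}
    {f g : Ω → ℝ} (hf : Integrable f m) (hg : Measurable g) (hg1 : ∀ x, |g x| ≤ 1) :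
    Integrable (fun x => f x * g x) m :=
  hf.mul_bdd (c := 1) hg.aestronglyMeasurable (Eventually.of_forall fun x => by
    rw [Real.norm_eq_abs]; exact hg1 x)

theorem abs_mul_le_one {s t : ℝ} (hs : |s| ≤ 1) (ht : |t| ≤ 1) : |s * t| ≤ 1 := by
  rw [abs_mul]
  exact mul_le_one₀ hs (abs_nonneg _) ht

theorem memLp_of_abs_le_one [IsFiniteMeasure ν] {f : Y → ℝ} (hf : Measurable f)
    (hf1 : ∀ y, |f y| ≤ 1) :
    MemLp f 2 ν :=
  MemLp.of_bound hf.aestronglyMeasurable 1 (Eventually.of_forall fun y => by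
    rw [Real.norm_eq_abs]; exact hf1 y)

theorem integrable_triple_term {ι : Type*} {a : ι → X → ℝ} {b : ι → Y → ℝ}
    (ha : ∀ i, Measurable (a i)) (hb : ∀ i, Measurable (b i))
    (ha1 : ∀ i x, |a i x| ≤ 1) (hb1 : ∀ i y, |b i y| ≤ 1)
    {P : ι → X → ℝ} {Q : ι → Y → ℝ} (hP : ∀ i, Integrable (P i) μ)
    (hQ : ∀ i, Integrable (Q i) ν) (t : ι × ι × ι) :
    Integrable (fun z : X × Y => (P t.2.1 z.1 * (a t.1 z.1 * a t.2.2 z.1)) *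
        (Q t.2.2 z.2 * (b t.1 z.2 * b t.2.1 z.2))) (μ.prod ν) :=
  (integrable_mul_of_abs_le_one (hP t.2.1) ((ha t.1).mul (ha t.2.2))
    fun x => abs_mul_le_one (ha1 _ x) (ha1 _ x)).mul_prod
  (integrable_mul_of_abs_le_one (hQ t.2.2) ((hb t.1).mul (hb t.2.1))
    fun x => abs_mul_le_one (hb1 _ x) (hb1 _ x))

variable {ι : Type*} [Fintype ι] {a : ι → X → ℝ} {b : ι → Y → ℝ}

variable (ha : ∀ i, Measurable (a i)) (hb : ∀ i, Measurable (b i))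
  (ha1 : ∀ i x, |a i x| ≤ 1) (hb1 : ∀ i y, |b i y| ≤ 1)
include ha hb ha1 hb1

theorem integrable_triple {P : ι → X → ℝ} {Q : ι → Y → ℝ} (hP : ∀ i, Integrable (P i) μ)
    (hQ : ∀ i, Integrable (Q i) ν) :
    Integrable (fun z : X × Y => (∑ i, a i z.1 * b i z.2) * (∑ i, P i z.1 * b i z.2) *
      (∑ i, a i z.1 * Q i z.2)) (μ.prod ν) := by
  simp only [triple_product_eq_sum]
  exact integrable_finsetSum _ fun t _ => integrable_triple_term ha hb ha1 hb1 hP hQ t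

variable [IsProbabilityMeasure μ] [IsProbabilityMeasure ν]

theorem integral_triple {P : ι → X → ℝ} {Q : ι → Y → ℝ} (hP : ∀ i, Integrable (P i) μ)
    (hQ : ∀ i, Integrable (Q i) ν) :
    ∫ z, (∑ i, a i z.1 * b i z.2) * (∑ i, P i z.1 * b i z.2) *
      (∑ i, a i z.1 * Q i z.2) ∂μ.prod ν =
    ∑ t : ι × ι × ι, (∫ x, P t.2.1 x * (a t.1 x * a t.2.2 x) ∂μ) *
      ∫ y, Q t.2.2 y * (b t.1 y * b t.2.1 y) ∂ν := by
  simp only [triple_product_eq_sum]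
  rw [integral_finsetSum _ fun t _ => integrable_triple_term ha hb ha1 hb1 hP hQ t]
  exact Finset.sum_congr rfl fun t _ => integral_prod_mul
    (fun x => P t.2.1 x * (a t.1 x * a t.2.2 x)) fun y => Q t.2.2 y * (b t.1 y * b t.2.1 y)

theorem integral_pow_three_le_triple {S₁ : X ≃ᵐ X} {S₂ : Y ≃ᵐ Y}
    (h₁ : MeasurePreserving S₁ μ μ) (h₂ : MeasurePreserving S₂ ν ν)
    (ma : ∀ i, MemLp (a i) 2 μ) (mb : ∀ i, MemLp (b i) 2 ν)
    (h0 : ∀ x y, 0 ≤ ∑ i, a i x * b i y) (hle : ∀ x y, ∑ i, a i x * b i y ≤ 1) :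
    (∫ z, ∑ i, a i z.1 * b i z.2 ∂μ.prod ν) ^ 3 ≤
      ∫ z, (∑ i, a i z.1 * b i z.2) *
        (∑ i, almostPeriodicPart h₁ ((ma i).toLp) z.1 * b i z.2) *
        (∑ i, a i z.1 * almostPeriodicPart h₂ ((mb i).toLp) z.2) ∂μ.prod ν := by
  have hiP : ∀ i, Integrable (almostPeriodicPart h₁ ((ma i).toLp)) μ := fun i =>
    (Lp.memLp _).integrable one_le_two
  have hiQ : ∀ i, Integrable (almostPeriodicPart h₂ ((mb i).toLp)) ν := fun i =>
    (Lp.memLp _).integrable one_le_two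
  have hfm : Measurable fun z : X × Y => ∑ i, a i z.1 * b i z.2 := measurable_sum_mul ha hb
  have hf1 : ∀ z : X × Y, |∑ i, a i z.1 * b i z.2| ≤ 1 := fun z => by
    rw [abs_of_nonneg (h0 _ _)]; exact hle _ _
  have he₁ : Measurable fun z : X × Y =>
      ∑ i, almostPeriodicPart h₁ ((ma i).toLp) z.1 * b i z.2 :=
    measurable_sum_mul (fun i => measurable_coeFn_Lp _) hb
  have he₂ : Measurable fun z : X × Y =>
      ∑ i, a i z.1 * almostPeriodicPart h₂ ((mb i).toLp) z.2 :=
    measurable_sum_mul ha fun i => measurable_coeFn_Lp _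
  have hi : ∀ i, Integrable (b i) ν := fun i => (mb i).integrable one_le_two
  have hi' : ∀ i, Integrable (a i) μ := fun i => (ma i).integrable one_le_two
  have h0' : ∀ y x, 0 ≤ ∑ i, b i y * a i x := fun y x => by
    simpa only [mul_comm] using h0 x y
  have hle' : ∀ y x, ∑ i, b i y * a i x ≤ 1 := fun y x => by
    simpa only [mul_comm] using hle x y
  refine integral_pow_three_le (Integrable.of_bound hfm.aestronglyMeasurable 1
    (Eventually.of_forall hf1)) (fun z => h0 _ _) he₁.aestronglyMeasurable
    he₂.aestronglyMeasurable ?_ ?_ ?_ ?_ ?_ ?_ ?_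
  · have := sum_mul_almostPeriodicPart_nonneg (μ := ν) h₁ hb ma h0'
    filter_upwards [(Measure.measurePreserving_swap (μ := μ) (ν := ν)).quasiMeasurePreserving.ae
      this] with z hz
    simpa only [mul_comm, Prod.fst_swap, Prod.snd_swap] using hz
  · exact sum_mul_almostPeriodicPart_nonneg (μ := μ) h₂ ha mb h0
  · simp only [mul_comm (∑ i, a i _ * b i _)]
    exact integrable_mul_of_abs_le_one
      (integrable_finsetSum _ fun i _ => (hiP i).mul_prod (hi i)) hfm hf1
  · simp only [mul_comm (∑ i, a i _ * b i _)]
    exact integrable_mul_of_abs_le_one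
      (integrable_finsetSum _ fun i _ => (hi' i).mul_prod (hiQ i)) hfm hf1
  · exact integrable_triple ha hb ha1 hb1 hiP hiQ
  · intro δ hδ
    have := integral_sum_mul_inv_le (μ := ν) h₁ hb ha ma h0' hle' hδ
    rw [← integral_prod_swap] at this
    simpa only [mul_comm (b _ _), Prod.fst_swap, Prod.snd_swap] using this
  · intro δ hδ
    exact integral_sum_mul_inv_le (μ := μ) h₂ ha hb mb h0 hle hδ

theorem syndetic_integral_triple {S₁ : X ≃ᵐ X} {S₂ : Y ≃ᵐ Y}
    (h₁ : MeasurePreserving S₁ μ μ) (h₂ : MeasurePreserving S₂ ν ν)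
    (h0 : ∀ x y, 0 ≤ ∑ i, a i x * b i y) (hle : ∀ x y, ∑ i, a i x * b i y ≤ 1)
    {ε : ℝ} (hε : 0 < ε) :
    Syndetic {n : ℤ | (∫ z, ∑ i, a i z.1 * b i z.2 ∂μ.prod ν) ^ 3 - ε <
      ∫ z, (∑ i, a i z.1 * b i z.2) *
        (∑ i, a i ((S₁.toEquiv ^ (-n) : Equiv.Perm X) z.1) * b i z.2) *
        (∑ i, a i z.1 * b i ((S₂.toEquiv ^ (-n) : Equiv.Perm Y) z.2)) ∂μ.prod ν} := by
  have ma : ∀ i, MemLp (a i) 2 μ := fun i => memLp_of_abs_le_one (ha i) (ha1 i)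
  have mb : ∀ i, MemLp (b i) 2 ν := fun i => memLp_of_abs_le_one (hb i) (hb1 i)
  have mu : ∀ t : ι × ι × ι, MemLp (fun x => a t.1 x * a t.2.2 x) 2 μ := fun t =>
    memLp_of_abs_le_one ((ha _).mul (ha _)) fun x => abs_mul_le_one (ha1 _ x) (ha1 _ x)
  have mv : ∀ t : ι × ι × ι, MemLp (fun y => b t.1 y * b t.2.1 y) 2 ν := fun t =>
    memLp_of_abs_le_one ((hb _).mul (hb _)) fun x => abs_mul_le_one (hb1 _ x) (hb1 _ x)
  have hiP : ∀ i, Integrable (almostPeriodicPart h₁ ((ma i).toLp)) μ := fun i =>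
    (Lp.memLp _).integrable one_le_two
  have hiQ : ∀ i, Integrable (almostPeriodicPart h₂ ((mb i).toLp)) ν := fun i =>
    (Lp.memLp _).integrable one_le_two
  have key := integral_pow_three_le_triple ha hb ha1 hb1 h₁ h₂ ma mb h0 hle
  rw [integral_triple ha hb ha1 hb1 hiP hiQ] at key
  refine (syndetic_sum_inner_mul_inner (koopman h₁) (koopman h₂)
    (fun t : ι × ι × ι => (ma t.2.1).toLp) (fun t => almostPeriodicPart h₁ ((ma t.2.1).toLp))
    (fun t => (mu t).toLp) (fun t => (mb t.2.2).toLp)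
    (fun t => almostPeriodicPart h₂ ((mb t.2.2).toLp)) (fun t => (mv t).toLp)
    (fun t => almostPeriodic_almostPeriodicPart h₁ _)
    (fun t => almostPeriodic_almostPeriodicPart h₂ _)
    (fun t => inner_sub_almostPeriodicPart h₁ _) (fun t => inner_sub_almostPeriodicPart h₂ _)
    hε).mono fun n hn => ?_
  rw [mem_ofPred_eq] at hn ⊢
  have hP := measurePreserving_zpow h₁ (-n)
  have hQ := measurePreserving_zpow h₂ (-n)
  rw [integral_triple ha hb ha1 hb1 (P := fun i x => a i ((S₁.toEquiv ^ (-n) : Equiv.Perm X) x))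
    (Q := fun i y => b i ((S₂.toEquiv ^ (-n) : Equiv.Perm Y) y))
    (fun i => hP.integrable_comp_of_integrable ((ma i).integrable one_le_two))
    (fun i => hQ.integrable_comp_of_integrable ((mb i).integrable one_le_two))]
  have e1 : ∀ t : ι × ι × ι, inner ℝ ((koopman h₁ ^ n) ((ma t.2.1).toLp)) ((mu t).toLp) =
      ∫ x, a t.2.1 ((S₁.toEquiv ^ (-n) : Equiv.Perm X) x) * (a t.1 x * a t.2.2 x) ∂μ := by
    intro t
    rw [inner_Lp_eq_integral]
    refine integral_congr_ae ?_
    filter_upwards [coeFn_koopman_zpow h₁ n ((ma t.2.1).toLp), (mu t).coeFn_toLp,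
      hP.quasiMeasurePreserving.ae_eq_comp (ma t.2.1).coeFn_toLp] with x h3 h4 h5
    rw [h3, h4, h5]
    rfl
  have e2 : ∀ t : ι × ι × ι, inner ℝ ((koopman h₂ ^ n) ((mb t.2.2).toLp)) ((mv t).toLp) =
      ∫ y, b t.2.2 ((S₂.toEquiv ^ (-n) : Equiv.Perm Y) y) * (b t.1 y * b t.2.1 y) ∂ν := by
    intro t
    rw [inner_Lp_eq_integral]
    refine integral_congr_ae ?_
    filter_upwards [coeFn_koopman_zpow h₂ n ((mb t.2.2).toLp), (mv t).coeFn_toLp,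
      hQ.quasiMeasurePreserving.ae_eq_comp (mb t.2.2).coeFn_toLp] with x h3 h4 h5
    rw [h3, h4, h5]
    rfl
  have e3 : ∀ t : ι × ι × ι, inner ℝ (almostPeriodicPart h₁ ((ma t.2.1).toLp)) ((mu t).toLp) =
      ∫ x, almostPeriodicPart h₁ ((ma t.2.1).toLp) x * (a t.1 x * a t.2.2 x) ∂μ := by
    intro t
    rw [inner_Lp_eq_integral]
    refine integral_congr_ae ?_
    filter_upwards [(mu t).coeFn_toLp] with x h4
    rw [h4]
  have e4 : ∀ t : ι × ι × ι, inner ℝ (almostPeriodicPart h₂ ((mb t.2.2).toLp)) ((mv t).toLp) =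
      ∫ y, almostPeriodicPart h₂ ((mb t.2.2).toLp) y * (b t.1 y * b t.2.1 y) ∂ν := by
    intro t
    rw [inner_Lp_eq_integral]
    refine integral_congr_ae ?_
    filter_upwards [(mv t).coeFn_toLp] with x h4
    rw [h4]
  simp only [e1, e2, e3, e4] at hn
  linarith [(abs_lt.1 hn).1]

end Triple

section SumsOfProducts

variable {X Y : Type*} [MeasurableSpace X] [MeasurableSpace Y]

/-- A finite sum of products of measurable functions of one variable bounded by one. -/
def IsSumOfProducts (f : X × Y → ℝ) : Prop :=
  ∃ (ι : Type) (_ : Fintype ι) (a : ι → X → ℝ) (b : ι → Y → ℝ),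
    (∀ i, Measurable (a i)) ∧ (∀ i, Measurable (b i)) ∧ (∀ i x, |a i x| ≤ 1) ∧
    (∀ i y, |b i y| ≤ 1) ∧ ∀ z, f z = ∑ i, a i z.1 * b i z.2

theorem IsSumOfProducts.measurable {f : X × Y → ℝ} (hf : IsSumOfProducts f) : Measurable f := by
  obtain ⟨ι, _, a, b, ha, hb, -, -, h⟩ := hf
  rw [funext h]
  exact measurable_sum_mul ha hb

theorem isSumOfProducts_mul {a : X → ℝ} {b : Y → ℝ} (ha : Measurable a) (hb : Measurable b)
    (ha1 : ∀ x, |a x| ≤ 1) (hb1 : ∀ y, |b y| ≤ 1) :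
    IsSumOfProducts fun z : X × Y => a z.1 * b z.2 :=
  ⟨Unit, inferInstance, fun _ => a, fun _ => b, fun _ => ha, fun _ => hb, fun _ => ha1,
    fun _ => hb1, fun z => by simp⟩

theorem IsSumOfProducts.one_sub {f : X × Y → ℝ} (hf : IsSumOfProducts f) :
    IsSumOfProducts fun z => 1 - f z := by
  obtain ⟨ι, _, a, b, ha, hb, ha1, hb1, h⟩ := hf
  refine ⟨Option ι, inferInstance, fun o x => o.elim 1 fun i => -a i x,
    fun o y => o.elim 1 fun i => b i y, ?_, ?_, ?_, ?_, fun z => ?_⟩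
  · rintro (_ | i)
    exacts [measurable_const, (ha i).neg]
  · rintro (_ | i)
    exacts [measurable_const, hb i]
  · rintro (_ | i) x
    · simp
    · simpa using ha1 i x
  · rintro (_ | i) y
    · simp
    · simpa using hb1 i y
  · simp [Fintype.sum_option, h, sub_eq_add_neg]

theorem IsSumOfProducts.mul {f g : X × Y → ℝ} (hf : IsSumOfProducts f)
    (hg : IsSumOfProducts g) : IsSumOfProducts fun z => f z * g z := by
  obtain ⟨ι, _, a, b, ha, hb, ha1, hb1, h⟩ := hf
  obtain ⟨κ, _, a', b', ha', hb', ha1', hb1', h'⟩ := hg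
  refine ⟨ι × κ, inferInstance, fun t x => a t.1 x * a' t.2 x, fun t y => b t.1 y * b' t.2 y,
    fun t => (ha _).mul (ha' _), fun t => (hb _).mul (hb' _),
    fun t x => abs_mul_le_one (ha1 _ x) (ha1' _ x),
    fun t x => abs_mul_le_one (hb1 _ x) (hb1' _ x), fun z => ?_⟩
  simp only [h, h', Finset.sum_mul_sum, Fintype.sum_prod_type]
  exact Finset.sum_congr rfl fun i _ => Finset.sum_congr rfl fun j _ => by ring

theorem abs_indicator_one_le_one {α : Type*} (s : Set α) (x : α) :
    |s.indicator (1 : α → ℝ) x| ≤ 1 := by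
  by_cases h : x ∈ s <;> simp [h]

theorem isSetAlgebra_isSumOfProducts :
    IsSetAlgebra {s : Set (X × Y) | IsSumOfProducts (s.indicator 1)} := by
  have hc : ∀ ⦃s : Set (X × Y)⦄, IsSumOfProducts (s.indicator 1) →
      IsSumOfProducts (sᶜ.indicator 1) := fun s hs => by
    convert hs.one_sub using 1
    funext z
    by_cases h : z ∈ s <;> simp [h]
  refine ⟨?_, hc, fun s t hs ht => ?_⟩
  · convert isSumOfProducts_mul (X := X) (Y := Y) (measurable_const (a := (0 : ℝ)))
      (measurable_const (a := (0 : ℝ))) (by simp) (by simp) using 1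
    simp [Set.indicator_empty]
  · change IsSumOfProducts ((s ∪ t).indicator 1)
    convert hc (s := sᶜ ∩ tᶜ) ?_ using 2
    · rw [compl_inter, compl_compl, compl_compl]
    · convert (hc hs).mul (hc ht) using 1
      exact inter_indicator_one

theorem generateFrom_isSumOfProducts :
    (Prod.instMeasurableSpace : MeasurableSpace (X × Y)) =
      MeasurableSpace.generateFrom {s : Set (X × Y) | IsSumOfProducts (s.indicator 1)} := by
  refine le_antisymm ?_ (MeasurableSpace.generateFrom_le fun s hs => ?_)
  · rw [← generateFrom_prod]
    refine MeasurableSpace.generateFrom_mono ?_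
    rintro _ ⟨s, hs, t, ht, rfl⟩
    rw [mem_ofPred_eq]
    convert isSumOfProducts_mul (measurable_one.indicator hs) (measurable_one.indicator ht)
      (abs_indicator_one_le_one s) (abs_indicator_one_le_one t) using 1
    funext z
    by_cases h1 : z.1 ∈ s <;> by_cases h2 : z.2 ∈ t <;> simp [h1, h2, indicator, mem_prod]
  · have := hs.measurable (measurableSet_singleton (1 : ℝ))
    convert this using 1
    ext z
    by_cases h : z ∈ s <;> simp [h]

end SumsOfProducts

theorem measureReal_inter_preimage_le {Ω : Type*} [MeasurableSpace Ω] {m : Measure Ω}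
    [IsFiniteMeasure m] {τ₁ τ₂ : Ω → Ω} (h₁ : MeasurePreserving τ₁ m m)
    (h₂ : MeasurePreserving τ₂ m m) {A B : Set Ω} (hA : MeasurableSet A) (hB : MeasurableSet B) :
    m.real (B ∩ τ₁ ⁻¹' B ∩ τ₂ ⁻¹' B) ≤
      m.real (A ∩ τ₁ ⁻¹' A ∩ τ₂ ⁻¹' A) + 3 * m.real (symmDiff A B) := by
  have hsub : B ∩ τ₁ ⁻¹' B ∩ τ₂ ⁻¹' B ⊆ (A ∩ τ₁ ⁻¹' A ∩ τ₂ ⁻¹' A) ∪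
      (symmDiff A B ∪ (τ₁ ⁻¹' symmDiff A B ∪ τ₂ ⁻¹' symmDiff A B)) := by
    intro x hx
    simp only [mem_union, mem_inter_iff, mem_preimage, mem_symmDiff] at hx ⊢
    tauto
  have hD : NullMeasurableSet (symmDiff A B) m := (hA.symmDiff hB).nullMeasurableSet
  have e₁ : m.real (τ₁ ⁻¹' symmDiff A B) = m.real (symmDiff A B) := h₁.measureReal_preimage hD
  have e₂ : m.real (τ₂ ⁻¹' symmDiff A B) = m.real (symmDiff A B) := h₂.measureReal_preimage hD
  have i1 := measureReal_mono (μ := m) hsub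
  have i2 := measureReal_union_le (μ := m) (A ∩ τ₁ ⁻¹' A ∩ τ₂ ⁻¹' A)
    (symmDiff A B ∪ (τ₁ ⁻¹' symmDiff A B ∪ τ₂ ⁻¹' symmDiff A B))
  have i3 := measureReal_union_le (μ := m) (symmDiff A B)
    (τ₁ ⁻¹' symmDiff A B ∪ τ₂ ⁻¹' symmDiff A B)
  have i4 := measureReal_union_le (μ := m) (τ₁ ⁻¹' symmDiff A B) (τ₂ ⁻¹' symmDiff A B)
  linarith

theorem pow_three_le_add_of_abs_sub_le {s t η : ℝ} (hs : 0 ≤ s) (hs1 : s ≤ 1) (ht : 0 ≤ t)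
    (ht1 : t ≤ 1) (h : |s - t| ≤ η) : s ^ 3 ≤ t ^ 3 + 3 * η := by
  have h1 := (abs_le.1 h).2
  have hη := (abs_nonneg _).trans h
  have h2 : s ^ 3 - t ^ 3 = (s - t) * (s ^ 2 + s * t + t ^ 2) := by ring
  have h3 : s ^ 2 + s * t + t ^ 2 ≤ 3 := by nlinarith
  have h4 : (s - t) * (s ^ 2 + s * t + t ^ 2) ≤ η * 3 :=
    (mul_le_mul_of_nonneg_right h1 (by positivity)).trans (mul_le_mul_of_nonneg_left h3 hη)
  linarith

section Recurrence

variable {X Y : Type*} [MeasurableSpace X] [MeasurableSpace Y] {μ : Measure X} {ν : Measure Y}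
  [IsProbabilityMeasure μ] [IsProbabilityMeasure ν] {S₁ : X ≃ᵐ X} {S₂ : Y ≃ᵐ Y}

theorem syndetic_measureReal_inter_of_isSumOfProducts
    (h₁ : MeasurePreserving S₁ μ μ) (h₂ : MeasurePreserving S₂ ν ν)
    {B : Set (X × Y)} (hBm : MeasurableSet B) (hB : IsSumOfProducts (B.indicator 1))
    {ε : ℝ} (hε : 0 < ε) :
    Syndetic {n : ℤ | (μ.prod ν).real B ^ 3 - ε < (μ.prod ν).real
      (B ∩ Prod.map (S₁.toEquiv ^ (-n) : Equiv.Perm X) id ⁻¹' B ∩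
        Prod.map id (S₂.toEquiv ^ (-n) : Equiv.Perm Y) ⁻¹' B)} := by
  obtain ⟨ι, _, a, b, ha, hb, ha1, hb1, h⟩ := hB
  have h0 : ∀ x y, 0 ≤ ∑ i, a i x * b i y := fun x y => by
    rw [← h (x, y)]; exact indicator_nonneg (fun _ _ => zero_le_one) _
  have hle : ∀ x y, ∑ i, a i x * b i y ≤ 1 := fun x y => by
    rw [← h (x, y)]; exact (le_abs_self _).trans (abs_indicator_one_le_one _ _)
  refine (syndetic_integral_triple ha hb ha1 hb1 h₁ h₂ h0 hle hε).mono fun n hn => ?_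
  rw [mem_ofPred_eq] at hn ⊢
  have m₁ := ((measurePreserving_zpow h₁ (-n)).prod (MeasurePreserving.id ν)).measurable
  have m₂ := ((MeasurePreserving.id μ).prod (measurePreserving_zpow h₂ (-n))).measurable
  rw [← integral_indicator_one hBm, ← integral_indicator_one ((hBm.inter (m₁ hBm)).inter (m₂ hBm))]
  have e₁ : ∀ z : X × Y, (Prod.map (S₁.toEquiv ^ (-n) : Equiv.Perm X) id ⁻¹' B).indicator
      (1 : X × Y → ℝ) z = ∑ i, a i ((S₁.toEquiv ^ (-n) : Equiv.Perm X) z.1) * b i z.2 :=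
    fun z => h (Prod.map (S₁.toEquiv ^ (-n) : Equiv.Perm X) id z)
  have e₂ : ∀ z : X × Y, (Prod.map id (S₂.toEquiv ^ (-n) : Equiv.Perm Y) ⁻¹' B).indicator
      (1 : X × Y → ℝ) z = ∑ i, a i z.1 * b i ((S₂.toEquiv ^ (-n) : Equiv.Perm Y) z.2) :=
    fun z => h (Prod.map id (S₂.toEquiv ^ (-n) : Equiv.Perm Y) z)
  simp only [inter_indicator_one, Pi.mul_apply, h, e₁, e₂]
  exact hn

/-- Multiple recurrence for the two coordinate actions on a product system. -/
theorem syndetic_measureReal_inter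
    (h₁ : MeasurePreserving S₁ μ μ) (h₂ : MeasurePreserving S₂ ν ν)
    {A : Set (X × Y)} (hA : MeasurableSet A) {ε : ℝ} (hε : 0 < ε) :
    Syndetic {n : ℤ | (μ.prod ν).real A ^ 3 - ε < (μ.prod ν).real
      (A ∩ Prod.map (S₁.toEquiv ^ (-n) : Equiv.Perm X) id ⁻¹' A ∩
        Prod.map id (S₂.toEquiv ^ (-n) : Equiv.Perm Y) ⁻¹' A)} := by
  obtain ⟨B, hB, hAB⟩ := (Measure.MeasureDense.of_generateFrom_isSetAlgebra_finite (μ.prod ν)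
    isSetAlgebra_isSumOfProducts generateFrom_isSumOfProducts).approx A hA (by finiteness)
    (ε / 12) (by positivity)
  have hBm : MeasurableSet B := by
    rw [generateFrom_isSumOfProducts]
    exact MeasurableSpace.measurableSet_generateFrom hB
  have hd : (μ.prod ν).real (symmDiff A B) < ε / 12 :=
    (ENNReal.lt_ofReal_iff_toReal_lt (by finiteness)).1 hAB
  refine (syndetic_measureReal_inter_of_isSumOfProducts h₁ h₂ hBm hB (half_pos hε)).mono
    fun n hn => ?_
  rw [mem_ofPred_eq] at hn ⊢
  have i1 := measureReal_inter_preimage_le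
    ((measurePreserving_zpow h₁ (-n)).prod (MeasurePreserving.id ν))
    ((MeasurePreserving.id μ).prod (measurePreserving_zpow h₂ (-n))) hA hBm
  have i2 := pow_three_le_add_of_abs_sub_le measureReal_nonneg measureReal_le_one
    measureReal_nonneg measureReal_le_one
    (abs_measureReal_sub_le_measureReal_symmDiff (μ := μ.prod ν) hA.nullMeasurableSet
      hBm.nullMeasurableSet)
  linarith

end Recurrence

theorem zpow_prodCongr_refl {X Y : Type*} [MeasurableSpace X] [MeasurableSpace Y] (S : X ≃ᵐ X)
    (n : ℤ) : (S.prodCongr (MeasurableEquiv.refl Y)).toEquiv ^ n =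
      (Equiv.prodCongr (S.toEquiv ^ n) (Equiv.refl Y) : Equiv.Perm (X × Y)) := by
  induction n using Int.induction_on with
  | zero => rfl
  | succ n ih => rw [zpow_add_one, zpow_add_one, ih]; rfl
  | pred n ih => rw [zpow_sub_one, zpow_sub_one, ih]; rfl

theorem zpow_refl_prodCongr {X Y : Type*} [MeasurableSpace X] [MeasurableSpace Y] (S : Y ≃ᵐ Y)
    (n : ℤ) : ((MeasurableEquiv.refl X).prodCongr S).toEquiv ^ n =
      (Equiv.prodCongr (Equiv.refl X) (S.toEquiv ^ n) : Equiv.Perm (X × Y)) := by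
  induction n using Int.induction_on with
  | zero => rfl
  | succ n ih => rw [zpow_add_one, zpow_add_one, ih]; rfl
  | pred n ih => rw [zpow_sub_one, zpow_sub_one, ih]; rfl

theorem image_zpow {X : Type*} (T : Equiv.Perm X) (n : ℤ) (A : Set X) :
    ⇑(T ^ n) '' A = ⇑(T ^ (-n)) ⁻¹' A := by
  rw [zpow_neg]
  exact Equiv.image_eq_preimage_symm _ _

theorem multiple_recurrence_product_system
    {Y₁ Y₂ : Type*} [MeasurableSpace Y₁] [MeasurableSpace Y₂]
    (ν₁ : Measure Y₁) (ν₂ : Measure Y₂)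
    [IsProbabilityMeasure ν₁] [IsProbabilityMeasure ν₂]
    (S₁ : Y₁ ≃ᵐ Y₁) (S₂ : Y₂ ≃ᵐ Y₂)
    (h₁ : MeasurePreserving S₁ ν₁ ν₁) (h₂ : MeasurePreserving S₂ ν₂ ν₂)
    (e₁ : ∀ s : Set Y₁, MeasurableSet s → S₁ ⁻¹' s = s → ν₁ s = 0 ∨ ν₁ s = 1)
    (e₂ : ∀ s : Set Y₂, MeasurableSet s → S₂ ⁻¹' s = s → ν₂ s = 0 ∨ ν₂ s = 1)
    (A : Set (Y₁ × Y₂)) (hA : MeasurableSet A) (hA0 : 0 < (ν₁.prod ν₂) A)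
    (ε : ℝ) (hε : 0 < ε) :
    Syndetic {n : ℤ |
      ((ν₁.prod ν₂) (A ∩
          ⇑((S₁.prodCongr (MeasurableEquiv.refl Y₂)).toEquiv ^ n) '' A ∩
          ⇑(((MeasurableEquiv.refl Y₁).prodCongr S₂).toEquiv ^ n) '' A)).toReal >
        ((ν₁.prod ν₂) A).toReal ^ 3 - ε} := by
  refine (syndetic_measureReal_inter h₁ h₂ hA hε).mono fun n hn => ?_
  rw [Set.mem_ofPred_eq] at hn ⊢
  rw [image_zpow, image_zpow, zpow_prodCongr_refl, zpow_refl_prodCongr]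
  exact hn
end

section
/- Let (Y₁, ν₁, S₁) and (Y₂, ν₂, S₂) be two ergodic invertible measure-preserving systems, let (X, μ) = (Y₁ × Y₂, ν₁ × ν₂), and let T₁ = S₁ × id, T₂ = id × S₂. Let f be a measurable function on X with 0 ≤ f ≤ 1. Then for every ε > 0, the set {n ∈ ℤ : ∫ f · (f∘T₁ⁿ) · (f∘T₂ⁿ) dμ > (∫ f dμ)³ − ε} is syndetic. -/
open MeasureTheory

theorem Syndetic.of_forall_exists_sub_mem {E : Set ℤ}
    (h : ∀ t : ℕ → ℤ, ∃ l k, l < k ∧ t k - t l ∈ E) : Syndetic E := by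
  by_contra hE
  simp only [Syndetic, not_exists, not_and, not_forall] at hE
  obtain ⟨t, -, ht⟩ := exists_seq_of_forall_finset_exists (fun _ : ℤ => True)
    (fun x y => y - x ∉ E) (fun s _ => by
      obtain ⟨M, hM⟩ := hE (2 * ∑ x ∈ s, |x| + 1)
        (by have := Finset.sum_nonneg (fun x (_ : x ∈ s) => abs_nonneg x); omega)
      refine ⟨M + ∑ x ∈ s, |x|, trivial, fun x hx hmem => hM _ hmem ?_ ?_⟩ <;>
      · have := Finset.single_le_sum (fun x (_ : x ∈ s) => abs_nonneg x) hx
        have := abs_le.1 this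
        omega)
  obtain ⟨l, k, hlk, hmem⟩ := h t
  exact ht l k hlk hmem

section Powers

variable {Y₁ Y₂ : Type*} [MeasurableSpace Y₁] [MeasurableSpace Y₂]

theorem MeasurableEquiv.prodCongr_refl_zpow_apply (S : Y₁ ≃ᵐ Y₁) (n : ℤ) (p : Y₁ × Y₂) :
    ((S.prodCongr (MeasurableEquiv.refl Y₂)).toEquiv ^ n) p = ((S.toEquiv ^ n) p.1, p.2) := by
  induction n generalizing p with
  | zero => rfl
  | succ n ih => rw [zpow_add_one, zpow_add_one, Equiv.Perm.mul_apply, ih]; rfl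
  | pred n ih => rw [zpow_sub_one, zpow_sub_one, Equiv.Perm.mul_apply, ih]; rfl

theorem MeasurableEquiv.refl_prodCongr_zpow_apply (S : Y₂ ≃ᵐ Y₂) (n : ℤ) (p : Y₁ × Y₂) :
    (((MeasurableEquiv.refl Y₁).prodCongr S).toEquiv ^ n) p = (p.1, (S.toEquiv ^ n) p.2) := by
  induction n generalizing p with
  | zero => rfl
  | succ n ih => rw [zpow_add_one, zpow_add_one, Equiv.Perm.mul_apply, ih]; rfl
  | pred n ih => rw [zpow_sub_one, zpow_sub_one, Equiv.Perm.mul_apply, ih]; rfl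

theorem MeasureTheory.MeasurePreserving.zpow {ν : Measure Y₁} {S : Y₁ ≃ᵐ Y₁}
    (h : MeasurePreserving S ν ν) (n : ℤ) : MeasurePreserving (S.toEquiv ^ n) ν ν := by
  induction n with
  | zero => exact MeasurePreserving.id ν
  | succ n ih => rw [zpow_add_one]; exact ih.comp h
  | pred n ih => rw [zpow_sub_one]; exact ih.comp (h.symm S)

end Powers

open Filter Topology in
theorem exists_forall_tendsto_inner_of_ultrafilter {H α : Type*} [NormedAddCommGroup H]
    [InnerProductSpace ℝ H] [CompleteSpace H] (𝒰 : Ultrafilter α) {C : ℝ} (g : α → H)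
    (hg : ∀ k, ‖g k‖ ≤ C) :
    ∃ q : H, ∀ v, Tendsto (fun k => inner ℝ v (g k)) 𝒰 (𝓝 (inner ℝ v q)) := by
  have hc := WeakDual.isCompact_closedBall (0 : StrongDual ℝ H) C
  let G : α → WeakDual ℝ H := fun k => StrongDual.toWeakDual (InnerProductSpace.toDual ℝ H (g k))
  obtain ⟨Q, -, hQ⟩ := hc.ultrafilter_le_nhds (𝒰.map G) (by
    simp only [Ultrafilter.coe_map, le_principal_iff, mem_map]
    refine Filter.univ_mem' fun k => ?_
    simpa [G] using hg k)
  refine ⟨(InnerProductSpace.toDual ℝ H).symm (WeakDual.toStrongDual Q), fun v => ?_⟩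
  have h1 : Tendsto G 𝒰 (𝓝 Q) := hQ
  have h2 := ((WeakDual.eval_continuous v).tendsto Q).comp h1
  rw [real_inner_comm, InnerProductSpace.toDual_symm_apply]
  refine h2.congr fun k => ?_
  rw [real_inner_comm]
  rfl

section Blocks

open scoped ENNReal

variable {Y₁ Y₂ : Type*} [MeasurableSpace Y₁] [MeasurableSpace Y₂]

/-- `f` is an `L¹`-limit of functions constant on the cells of a finite measurable grid. -/
def BlockApproximable (ν₁ : Measure Y₁) (ν₂ : Measure Y₂) (f : Y₁ × Y₂ → ℝ) : Prop :=
  ∀ ε : ℝ≥0∞, ε ≠ 0 → ∃ (m n : ℕ) (a : Y₁ → Fin m) (b : Y₂ → Fin n) (c : Fin m → Fin n → ℝ),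
    Measurable a ∧ Measurable b ∧
      ∫⁻ p, ‖f p - c (a p.1) (b p.2)‖ₑ ∂(ν₁.prod ν₂) ≤ ε

theorem measurable_block {m n : ℕ} {a : Y₁ → Fin m} {b : Y₂ → Fin n} (ha : Measurable a)
    (hb : Measurable b) (c : Fin m → Fin n → ℝ) :
    Measurable fun p : Y₁ × Y₂ => c (a p.1) (b p.2) :=
  (Measurable.of_discrete (f := fun q : Fin m × Fin n => c q.1 q.2)).comp
    ((ha.comp measurable_fst).prodMk (hb.comp measurable_snd))

namespace BlockApproximable

variable {ν₁ : Measure Y₁} {ν₂ : Measure Y₂} {f g : Y₁ × Y₂ → ℝ}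

theorem of_lintegral_enorm_sub_le (hf : AEMeasurable f (ν₁.prod ν₂))
    (h : ∀ ε : ℝ≥0∞, ε ≠ 0 → ∃ g, AEMeasurable g (ν₁.prod ν₂) ∧ BlockApproximable ν₁ ν₂ g ∧
      ∫⁻ p, ‖f p - g p‖ₑ ∂(ν₁.prod ν₂) ≤ ε) : BlockApproximable ν₁ ν₂ f := by
  intro ε hε
  obtain ⟨g, hgm, hg, hfg⟩ := h (ε / 2) (by simpa using hε)
  obtain ⟨m, n, a, b, c, ha, hb, hc⟩ := hg (ε / 2) (by simpa using hε)
  refine ⟨m, n, a, b, c, ha, hb, ?_⟩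
  calc ∫⁻ p, ‖f p - c (a p.1) (b p.2)‖ₑ ∂(ν₁.prod ν₂)
      ≤ ∫⁻ p, ‖f p - g p‖ₑ + ‖g p - c (a p.1) (b p.2)‖ₑ ∂(ν₁.prod ν₂) :=
        lintegral_mono fun p => by
          rw [← sub_add_sub_cancel (f p) (g p)]; exact enorm_add_le _ _
    _ = _ := lintegral_add_left' (hf.sub hgm).enorm _
    _ ≤ ε / 2 + ε / 2 := add_le_add hfg hc
    _ = ε := ENNReal.add_halves ε

theorem add (hfm : AEMeasurable f (ν₁.prod ν₂)) (hf : BlockApproximable ν₁ ν₂ f)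
    (hg : BlockApproximable ν₁ ν₂ g) : BlockApproximable ν₁ ν₂ (f + g) := by
  intro ε hε
  obtain ⟨m, n, a, b, c, ha, hb, hc⟩ := hf (ε / 2) (by simpa using hε)
  obtain ⟨m', n', a', b', c', ha', hb', hc'⟩ := hg (ε / 2) (by simpa using hε)
  refine ⟨m * m', n * n', fun x => finProdFinEquiv (a x, a' x),
    fun y => finProdFinEquiv (b y, b' y),
    fun i j => c (finProdFinEquiv.symm i).1 (finProdFinEquiv.symm j).1 +
      c' (finProdFinEquiv.symm i).2 (finProdFinEquiv.symm j).2,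
    Measurable.of_discrete.comp (ha.prodMk ha'), Measurable.of_discrete.comp (hb.prodMk hb'), ?_⟩
  simp only [Equiv.symm_apply_apply, Pi.add_apply]
  calc _ ≤ ∫⁻ p, ‖f p - c (a p.1) (b p.2)‖ₑ + ‖g p - c' (a' p.1) (b' p.2)‖ₑ ∂(ν₁.prod ν₂) :=
        lintegral_mono fun p => by
          rw [add_sub_add_comm]; exact enorm_add_le _ _
    _ = _ := lintegral_add_left' (hfm.sub (measurable_block ha hb c).aemeasurable).enorm _
    _ ≤ ε / 2 + ε / 2 := add_le_add hc hc'
    _ = ε := ENNReal.add_halves ε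

theorem const (r : ℝ) : BlockApproximable ν₁ ν₂ fun _ => r := fun ε _ =>
  ⟨1, 1, fun _ => 0, fun _ => 0, fun _ _ => r, measurable_const, measurable_const, by simp⟩

theorem const_mul (r : ℝ) (hf : BlockApproximable ν₁ ν₂ f) :
    BlockApproximable ν₁ ν₂ fun p => r * f p := by
  intro ε hε
  rcases eq_or_ne r 0 with rfl | hr
  · simpa using const (ν₁ := ν₁) (ν₂ := ν₂) 0 ε hε
  obtain ⟨m, n, a, b, c, ha, hb, hc⟩ := hf (ε / ‖r‖ₑ) (by simp [hε])
  refine ⟨m, n, a, b, fun i j => r * c i j, ha, hb, ?_⟩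
  simp_rw [← mul_sub, enorm_mul]
  rw [lintegral_const_mul' _ _ (by simp)]
  exact (mul_le_mul_right hc _).trans ENNReal.mul_div_le

theorem indicator_prod {s : Set Y₁} {t : Set Y₂} (hs : MeasurableSet s) (ht : MeasurableSet t) :
    BlockApproximable ν₁ ν₂ ((s ×ˢ t).indicator fun _ => 1) := by
  classical
  intro ε _
  refine ⟨2, 2, fun x => if x ∈ s then 1 else 0, fun y => if y ∈ t then 1 else 0,
    fun i j => if i = 1 ∧ j = 1 then 1 else 0, Measurable.ite hs measurable_const measurable_const,
    Measurable.ite ht measurable_const measurable_const, ?_⟩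
  refine le_of_eq_of_le ((lintegral_congr fun p => ?_).trans lintegral_zero) zero_le
  by_cases h1 : p.1 ∈ s <;> by_cases h2 : p.2 ∈ t <;> simp [Set.indicator, h1, h2]

theorem indicator [IsFiniteMeasure ν₁] [IsFiniteMeasure ν₂] {E : Set (Y₁ × Y₂)}
    (hE : MeasurableSet E) : BlockApproximable ν₁ ν₂ (E.indicator fun _ => 1) := by
  induction E, hE using MeasurableSpace.induction_on_inter generateFrom_prod.symm
    isPiSystem_prod with
  | empty => simpa using const (ν₁ := ν₁) (ν₂ := ν₂) 0
  | basic t ht =>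
    obtain ⟨s, hs, t, ht, rfl⟩ := ht
    exact indicator_prod hs ht
  | compl t ht ih =>
    have := (const_mul (-1) ih).add
      ((measurable_const.indicator ht).const_mul (-1)).aemeasurable (const 1)
    convert this using 1
    ext p
    by_cases h : p ∈ t <;> simp [h]
  | iUnion F hd hF ih =>
    have hmeas : ∀ N, Measurable (∑ i ∈ Finset.range N, (F i).indicator fun _ => (1 : ℝ)) :=
      fun N => by
        rw [Finset.sum_fn]
        exact Finset.measurable_sum _ fun i _ => measurable_const.indicator (hF i)
    have hpart : ∀ N, BlockApproximable ν₁ ν₂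
        (∑ i ∈ Finset.range N, (F i).indicator fun _ => (1 : ℝ)) := by
      intro N
      induction N with
      | zero => exact const (ν₁ := ν₁) (ν₂ := ν₂) 0
      | succ N hN => rw [Finset.sum_range_succ]; exact add (hmeas N).aemeasurable hN (ih N)
    refine of_lintegral_enorm_sub_le
      (measurable_const.indicator (MeasurableSet.iUnion hF)).aemeasurable fun ε hε => ?_
    obtain ⟨N, hN⟩ := ((tendsto_measure_biUnion_Ici_zero_of_pairwise_disjoint (μ := ν₁.prod ν₂)
      (fun i => (hF i).nullMeasurableSet) hd).eventually_le_const
        (pos_iff_ne_zero.2 hε)).exists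
    refine ⟨_, (hmeas N).aemeasurable, hpart N, le_trans ?_ hN⟩
    simp only [Function.comp_apply]
    rw [← lintegral_indicator_one (MeasurableSet.iUnion fun i => MeasurableSet.iUnion fun _ => hF i)]
    refine lintegral_mono fun p => ?_
    by_cases hp : ∃ j, p ∈ F j
    · obtain ⟨j, hj⟩ := hp
      have hiff : ∀ i, p ∈ F i ↔ i = j := fun i =>
        ⟨fun hi => by_contra fun hij => Set.disjoint_left.1 (hd hij) hi hj, fun h => h ▸ hj⟩
      have hsum : (∑ i ∈ Finset.range N, (F i).indicator fun _ => (1 : ℝ)) p =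
          if j < N then 1 else 0 := by
        classical
        rw [Finset.sum_apply]
        simp [Set.indicator_apply, hiff]
      rw [hsum]
      by_cases hjN : j < N
      · simp [hiff, hjN]
      · rw [if_neg hjN]
        simp [hiff, not_lt.1 hjN]
    · push Not at hp
      simp [hp]

theorem of_integrable [IsFiniteMeasure ν₁] [IsFiniteMeasure ν₂]
    (hf : Integrable f (ν₁.prod ν₂)) : BlockApproximable ν₁ ν₂ f := by
  refine Integrable.induction _ (fun r E hE _ => ?_)
    (fun f g _ hf _ ihf ihg => add hf.aemeasurable ihf ihg) ?_ (fun f g hfg hf ih => ?_) hf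
  · convert const_mul r (indicator (ν₁ := ν₁) (ν₂ := ν₂) hE) using 1
    ext p
    by_cases h : p ∈ E <;> simp [h]
  · refine isClosed_of_closure_subset fun f hf => ?_
    refine of_lintegral_enorm_sub_le (Lp.aestronglyMeasurable f).aemeasurable fun ε hε => ?_
    obtain ⟨g, hg, hfg⟩ := EMetric.mem_closure_iff.1 hf ε (pos_iff_ne_zero.2 hε)
    refine ⟨g, (Lp.aestronglyMeasurable g).aemeasurable, hg, ?_⟩
    rw [Lp.edist_def, eLpNorm_one_eq_lintegral_enorm] at hfg
    exact hfg.le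
  · refine of_lintegral_enorm_sub_le (hf.aemeasurable.congr hfg) fun ε _ =>
      ⟨f, hf.aemeasurable, ih, ?_⟩
    rw [lintegral_congr_ae (g := fun _ => 0) (hfg.mono fun p hp => by simp [hp])]
    simp

theorem exists_block_of_measurable [IsFiniteMeasure ν₁] [IsFiniteMeasure ν₂]
    (hf : Measurable f) (hf0 : ∀ p, 0 ≤ f p) (hf1 : ∀ p, f p ≤ 1) {δ : ℝ} (hδ : 0 < δ)
    (hδ1 : δ ≤ 1) :
    ∃ (m n : ℕ) (a : Y₁ → Fin m) (b : Y₂ → Fin n) (c : Fin m → Fin n → ℝ),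
      Measurable a ∧ Measurable b ∧ (∀ i j, δ ≤ c i j) ∧ (∀ i j, c i j ≤ 1) ∧
        ∫ p, |f p - c (a p.1) (b p.2)| ∂(ν₁.prod ν₂) ≤
          δ * (1 + (ν₁.prod ν₂).real Set.univ) := by
  have hfi : Integrable f (ν₁.prod ν₂) := Integrable.of_bound hf.aestronglyMeasurable 1
    (Filter.Eventually.of_forall fun p => by simp [abs_of_nonneg (hf0 p), hf1 p])
  obtain ⟨m, n, a, b, c, ha, hb, hc⟩ := of_integrable hfi (ENNReal.ofReal δ) (by simpa using hδ)
  have hm := measurable_block ha hb c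
  have hd : Integrable (fun p => f p - c (a p.1) (b p.2)) (ν₁.prod ν₂) :=
    ⟨(hf.sub hm).aestronglyMeasurable, hc.trans_lt ENNReal.ofReal_lt_top⟩
  have hc' : ∫ p, |f p - c (a p.1) (b p.2)| ∂(ν₁.prod ν₂) ≤ δ := by
    simp_rw [← Real.norm_eq_abs]
    rw [integral_norm_eq_lintegral_enorm hd.aestronglyMeasurable]
    exact ENNReal.toReal_le_of_le_ofReal hδ.le hc
  refine ⟨m, n, a, b, fun i j => max δ (min (c i j) 1), ha, hb, fun _ _ => le_max_left _ _,
    fun _ _ => max_le hδ1 (min_le_right _ _), ?_⟩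
  calc _ ≤ ∫ p, (|f p - c (a p.1) (b p.2)| + δ) ∂(ν₁.prod ν₂) := by
        refine integral_mono_of_nonneg (Filter.Eventually.of_forall fun p => abs_nonneg _)
          (hd.abs.add (integrable_const _)) (Filter.Eventually.of_forall fun p => ?_)
        have h0 := hf0 p
        have h1 := hf1 p
        dsimp only
        generalize f p = x at *
        generalize c (a p.1) (b p.2) = y
        have := le_abs_self (x - y)
        have := neg_abs_le (x - y)
        rw [abs_le]
        rcases max_cases δ (min y 1) with h | h <;> rcases min_cases y 1 with h' | h' <;>
          constructor <;> linarith
    _ ≤ _ := by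
        rw [integral_add hd.abs (integrable_const _)]
        simp only [integral_const, smul_eq_mul]
        linarith

end BlockApproximable

end Blocks

section WeakLimit

open Filter Topology

variable {Y : Type*} [MeasurableSpace Y] {ν : Measure Y} [IsProbabilityMeasure ν] {m : ℕ}

/-- The cell indicators of a finite partition, moved along any sequence of powers of a
measure-preserving map, have weak limits forming a fractional partition. -/
theorem exists_fractional_partition {S : Y ≃ᵐ Y} (h : MeasurePreserving S ν ν)
    {a : Y → Fin m} (ha : Measurable a) (t : ℕ → ℤ) (𝒰 : Ultrafilter ℕ) :
    ∃ q : Fin m → Y → ℝ, (∀ i, Measurable (q i)) ∧ (∀ᵐ y ∂ν, ∀ i, 0 ≤ q i y) ∧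
      (∀ᵐ y ∂ν, ∑ i, q i y = 1) ∧ (∀ i, ∫ y, q i y ∂ν = ν.real {y | a y = i}) ∧
      ∀ i i', Tendsto (fun z : ℕ × ℕ =>
          ν.real {y | a y = i ∧ a ((S.toEquiv ^ (t z.2 - t z.1)) y) = i'})
        ((𝒰 : Filter ℕ).curry 𝒰) (𝓝 (∫ y, q i y * q i' y ∂ν)) := by
  let A : ℕ → Fin m → Set Y := fun k i => {y | a ((S.toEquiv ^ t k) y) = i}
  have hA : ∀ k i, MeasurableSet (A k i) := fun k i =>
    (ha.comp (h.zpow (t k)).measurable) (measurableSet_singleton i)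
  have hAν : ∀ k i, ν.real (A k i) = ν.real {y | a y = i} := fun k i =>
    (h.zpow (t k)).measureReal_preimage (ha (measurableSet_singleton i)).nullMeasurableSet
  let G : Fin m → ℕ → Lp ℝ 2 ν := fun i k => indicatorConstLp 2 (hA k i) (measure_ne_top ν _) 1
  have hG : ∀ i k, ‖G i k‖ ≤ 1 := fun i k => by
    have h1 : inner ℝ (G i k) (G i k) = ν.real (A k i ∩ A k i) :=
      L2.inner_indicatorConstLp_one_indicatorConstLp_one _ _ _ _
    rw [real_inner_self_eq_norm_sq] at h1
    have h2 : ν.real (A k i ∩ A k i) ≤ 1 := measureReal_le_one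
    nlinarith [norm_nonneg (G i k)]
  choose q hq using fun i => exists_forall_tendsto_inner_of_ultrafilter 𝒰 (G i) (hG i)
  have hset : ∀ i (s : Set Y), MeasurableSet s →
      Tendsto (fun k => ν.real (s ∩ A k i)) 𝒰 (𝓝 (∫ y in s, q i y ∂ν)) := fun i s hs => by
    have := hq i (indicatorConstLp 2 hs (measure_ne_top ν s) 1)
    rw [L2.inner_indicatorConstLp_one] at this
    exact this.congr fun k => L2.inner_indicatorConstLp_one_indicatorConstLp_one _ _ _ _
  have hint : ∀ i, Integrable (q i) ν := fun i => (Lp.memLp (q i)).integrable one_le_two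
  refine ⟨fun i => q i, fun i => (Lp.stronglyMeasurable (q i)).measurable, ?_, ?_, ?_, ?_⟩
  · refine ae_all_iff.2 fun i => ae_nonneg_of_forall_setIntegral_nonneg (hint i) fun s hs _ =>
      ge_of_tendsto' (hset i s hs) fun k => measureReal_nonneg
  · refine Integrable.ae_eq_of_forall_setIntegral_eq _ _ (integrable_finsetSum _ fun i _ => hint i)
      (integrable_const 1) fun s hs _ => ?_
    rw [integral_finsetSum _ fun i _ => (hint i).integrableOn]
    refine tendsto_nhds_unique (tendsto_finsetSum _ fun i _ => hset i s hs) ?_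
    simp only [setIntegral_const, smul_eq_mul, mul_one]
    refine tendsto_const_nhds.congr fun k => ?_
    have := measureReal_biUnion_finset (μ := ν) (s := Finset.univ) (f := fun i => s ∩ A k i)
      (fun i _ j _ hij => Set.disjoint_left.2 fun y hi hj => hij (hi.2.symm.trans hj.2))
      (fun i _ => hs.inter (hA k i))
    rw [← this]
    congr 1
    ext y
    simp [A]
  · intro i
    have := hset i Set.univ MeasurableSet.univ
    rw [setIntegral_univ] at this
    refine tendsto_nhds_unique this (tendsto_const_nhds.congr fun k => ?_)
    rw [Set.univ_inter, hAν]
  · intro i i'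
    have hcorr : ∀ l k, ν.real {y | a y = i ∧ a ((S.toEquiv ^ (t k - t l)) y) = i'} =
        inner ℝ (G i l) (G i' k) := fun l k => by
      rw [L2.inner_indicatorConstLp_one_indicatorConstLp_one]
      have hm : MeasurableSet {y | a y = i ∧ a ((S.toEquiv ^ (t k - t l)) y) = i'} :=
        (ha (measurableSet_singleton i)).inter
          ((ha.comp (h.zpow (t k - t l)).measurable) (measurableSet_singleton i'))
      rw [← (h.zpow (t l)).measureReal_preimage hm.nullMeasurableSet]
      congr 1
      ext y
      have : (S.toEquiv ^ (t k - t l)) ((S.toEquiv ^ t l) y) = (S.toEquiv ^ t k) y := by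
        rw [← Equiv.Perm.mul_apply, ← zpow_add, sub_add_cancel]
      simp [A, this]
    have hlim : ∫ y, q i y * q i' y ∂ν = inner ℝ (q i') (q i) := by
      rw [L2.inner_def]
      rfl
    rw [hlim, Metric.tendsto_nhds]
    intro ε hε
    rw [eventually_curry_iff]
    filter_upwards [Metric.tendsto_nhds.1 (hq i (q i')) (ε / 2) (half_pos hε)] with l hl
    filter_upwards [Metric.tendsto_nhds.1 (hq i' (G i l)) (ε / 2) (half_pos hε)] with k hk
    rw [hcorr]
    rw [real_inner_comm] at hl
    calc _ ≤ _ := dist_triangle _ (inner ℝ (G i l) (q i')) _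
      _ < ε / 2 + ε / 2 := add_lt_add hk hl
      _ = ε := add_halves ε

/-- The reciprocal moment bound for the averaging operator of a fractional partition `q`. -/
theorem sum_mul_sq_integral_div_le_one {q : Fin m → Y → ℝ} (hqm : ∀ i, Measurable (q i))
    (hq0 : ∀ᵐ y ∂ν, ∀ i, 0 ≤ q i y) (hq1 : ∀ᵐ y ∂ν, ∑ i, q i y = 1) {δ : ℝ} (hδ : 0 < δ)
    {c : Fin m → ℝ} (hc : ∀ i, δ ≤ c i) :
    (∀ i, δ * ∫ y, q i y ∂ν ≤ ∑ i', (∫ y, q i y * q i' y ∂ν) * c i') ∧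
    ∑ i, c i * ((∫ y, q i y ∂ν) ^ 2 / ∑ i', (∫ y, q i y * q i' y ∂ν) * c i') ≤ 1 := by
  have hq_le : ∀ᵐ y ∂ν, ∀ i, q i y ≤ 1 := by
    filter_upwards [hq0, hq1] with y h0 h1 i
    rw [← h1]
    exact Finset.single_le_sum (fun j _ => h0 j) (Finset.mem_univ i)
  have hqi : ∀ i, Integrable (q i) ν := fun i =>
    Integrable.of_bound (hqm i).aestronglyMeasurable 1 (by
      filter_upwards [hq0, hq_le] with y h0 h1
      rw [Real.norm_of_nonneg (h0 i)]
      exact h1 i)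
  have hqq : ∀ i i', Integrable (fun y => q i y * q i' y) ν := fun i i' =>
    (hqi i').bdd_mul (hqm i).aestronglyMeasurable (c := 1) (by
      filter_upwards [hq0, hq_le] with y h0 h1
      rw [Real.norm_of_nonneg (h0 i)]
      exact h1 i)
  let φ : Y → ℝ := fun y => ∑ i, q i y * c i
  have hφm : Measurable φ := Finset.measurable_sum _ fun i _ => (hqm i).mul_const _
  have hφ : ∀ᵐ y ∂ν, δ ≤ φ y := by
    filter_upwards [hq0, hq1] with y h0 h1
    calc δ = ∑ i, q i y * δ := by rw [← Finset.sum_mul, h1, one_mul]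
      _ ≤ φ y := Finset.sum_le_sum fun i _ => mul_le_mul_of_nonneg_left (hc i) (h0 i)
  have hexp : ∀ i y, q i y * φ y = ∑ i', q i y * q i' y * c i' := fun i y => by
    simp only [φ, Finset.mul_sum, mul_assoc]
  have hqφ : ∀ i, Integrable (fun y => q i y * φ y) ν := fun i => by
    simp only [hexp]
    exact integrable_finsetSum _ fun i' _ => (hqq i i').mul_const _
  have hb : ∀ i, ∑ i', (∫ y, q i y * q i' y ∂ν) * c i' = ∫ y, q i y * φ y ∂ν := fun i => by
    simp only [hexp]
    rw [integral_finsetSum _ fun i' _ => (hqq i i').mul_const _]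
    simp only [integral_mul_const]
  have hqd : ∀ i, Integrable (fun y => q i y / φ y) ν := fun i =>
    Integrable.of_bound ((hqm i).div hφm).aestronglyMeasurable (1 / δ) (by
      filter_upwards [hq0, hq_le, hφ] with y h0 h1 h2
      rw [Real.norm_of_nonneg (div_nonneg (h0 i) (hδ.le.trans h2))]
      exact div_le_div₀ zero_le_one (h1 i) hδ h2)
  simp only [hb]
  have hlow : ∀ i, δ * ∫ y, q i y ∂ν ≤ ∫ y, q i y * φ y ∂ν := fun i => by
    rw [← integral_const_mul]
    refine integral_mono_ae ((hqi i).const_mul δ) (hqφ i) ?_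
    filter_upwards [hq0, hφ] with y h0 h2
    rw [mul_comm]
    exact mul_le_mul_of_nonneg_left h2 (h0 i)
  refine ⟨hlow, ?_⟩
  have hα : ∀ i, 0 ≤ ∫ y, q i y ∂ν := fun i =>
    integral_nonneg_of_ae (hq0.mono fun y hy => hy i)
  have hcs : ∀ i, (∫ y, q i y ∂ν) ^ 2 / (∫ y, q i y * φ y ∂ν) ≤ ∫ y, q i y / φ y ∂ν := fun i => by
    rcases (hα i).eq_or_lt with h0 | hpos
    · rw [← h0, zero_pow two_ne_zero, zero_div]
      refine integral_nonneg_of_ae ?_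
      filter_upwards [hq0, hφ] with y h0 h2
      exact div_nonneg (h0 i) (hδ.le.trans h2)
    have hbpos : 0 < ∫ y, q i y * φ y ∂ν := (mul_pos hδ hpos).trans_le (hlow i)
    set α := ∫ y, q i y ∂ν with hαdef
    set b := ∫ y, q i y * φ y ∂ν with hbdef
    have h1 : ∫ y, (2 * (α / b) * q i y - (α / b) ^ 2 * (q i y * φ y)) ∂ν = α ^ 2 / b := by
      rw [integral_sub ((hqi i).const_mul _) ((hqφ i).const_mul _), integral_const_mul,
        integral_const_mul, ← hαdef, ← hbdef]
      field_simp
      ring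
    rw [← h1]
    refine integral_mono_ae (((hqi i).const_mul _).sub ((hqφ i).const_mul _)) (hqd i) ?_
    filter_upwards [hq0, hφ] with y h0 h2
    have hφpos : 0 < φ y := hδ.trans_le h2
    have : q i y / φ y - (2 * (α / b) * q i y - (α / b) ^ 2 * (q i y * φ y)) =
        q i y / φ y * (1 - α / b * φ y) ^ 2 := by
      field_simp
      ring
    have h3 : 0 ≤ q i y / φ y * (1 - α / b * φ y) ^ 2 :=
      mul_nonneg (div_nonneg (h0 i) hφpos.le) (sq_nonneg _)
    linarith
  calc _ ≤ ∑ i, c i * ∫ y, q i y / φ y ∂ν :=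
        Finset.sum_le_sum fun i _ => mul_le_mul_of_nonneg_left (hcs i) (hδ.le.trans (hc i))
    _ = ∫ y, ∑ i, c i * (q i y / φ y) ∂ν := by
        rw [integral_finsetSum _ fun i _ => (hqd i).const_mul _]
        simp only [integral_const_mul]
    _ = ∫ y, 1 ∂ν := by
        refine integral_congr_ae ?_
        filter_upwards [hφ] with y h2
        have hφpos : 0 < φ y := hδ.trans_le h2
        rw [← div_self hφpos.ne']
        nth_rewrite 3 [show φ y = ∑ i, q i y * c i from rfl]
        rw [Finset.sum_div]
        exact Finset.sum_congr rfl fun i _ => by ring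
    _ = 1 := by simp

end WeakLimit

theorem three_mul_sq_le_mul_add_div_add_div {a e C : ℝ} (ha : 0 < a) (he : 0 < e) (hC : 0 ≤ C) :
    3 * C ^ 2 ≤ a * e + C ^ 3 / a + C ^ 3 / e := by
  obtain ⟨u, hu, rfl⟩ : ∃ u, 0 < u ∧ u ^ 2 = a := ⟨√a, Real.sqrt_pos.2 ha, Real.sq_sqrt ha.le⟩
  obtain ⟨v, hv, rfl⟩ : ∃ v, 0 < v ∧ v ^ 2 = e := ⟨√e, Real.sqrt_pos.2 he, Real.sq_sqrt he.le⟩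
  have key : u ^ 2 * v ^ 2 + C ^ 3 / u ^ 2 + C ^ 3 / v ^ 2 - 3 * C ^ 2 =
      (u * v * (u * v - C) ^ 2 * (u * v + 2 * C) + C ^ 3 * (u - v) ^ 2) / (u ^ 2 * v ^ 2) := by
    field_simp
    ring
  have : 0 ≤ (u * v * (u * v - C) ^ 2 * (u * v + 2 * C) + C ^ 3 * (u - v) ^ 2) /
      (u ^ 2 * v ^ 2) := by positivity
  linarith

theorem sum_pow_three_le_sum_mul_mul {ι κ : Type*} [Fintype ι] [Fintype κ] {α : ι → ℝ} {β : κ → ℝ}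
    {c b d : ι → κ → ℝ} {δ : ℝ} (hδ : 0 < δ) (hα : ∀ i, 0 ≤ α i) (hβ : ∀ j, 0 ≤ β j)
    (hα1 : ∑ i, α i = 1) (hβ1 : ∑ j, β j = 1) (hc : ∀ i j, 0 ≤ c i j)
    (hb : ∀ i j, δ * α i ≤ b i j) (hd : ∀ i j, δ * β j ≤ d i j)
    (hb1 : ∀ j, ∑ i, c i j * (α i ^ 2 / b i j) ≤ 1)
    (hd1 : ∀ i, ∑ j, c i j * (β j ^ 2 / d i j) ≤ 1) :
    (∑ i, ∑ j, α i * β j * c i j) ^ 3 ≤ ∑ i, ∑ j, c i j * b i j * d i j := by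
  set C := ∑ i, ∑ j, α i * β j * c i j with hC
  have hC0 : 0 ≤ C := Finset.sum_nonneg fun i _ => Finset.sum_nonneg fun j _ =>
    mul_nonneg (mul_nonneg (hα i) (hβ j)) (hc i j)
  have hpt : ∀ i j, 3 * C ^ 2 * (α i * β j * c i j) ≤ c i j * b i j * d i j +
      C ^ 3 * (β j * (c i j * (α i ^ 2 / b i j))) +
      C ^ 3 * (α i * (c i j * (β j ^ 2 / d i j))) := fun i j => by
    have hb0 : 0 ≤ b i j := (mul_nonneg hδ.le (hα i)).trans (hb i j)
    have hd0 : 0 ≤ d i j := (mul_nonneg hδ.le (hβ j)).trans (hd i j)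
    have hci := hc i j
    have hαi := hα i
    have hβj := hβ j
    rcases (hα i).eq_or_lt with h0 | hαp
    · rw [← h0]
      have : 0 ≤ c i j * b i j * d i j := by positivity
      simpa using this
    rcases (hβ j).eq_or_lt with h0 | hβp
    · rw [← h0]
      have : 0 ≤ c i j * b i j * d i j := by positivity
      simpa using this
    have hbp : 0 < b i j := (mul_pos hδ hαp).trans_le (hb i j)
    have hdp : 0 < d i j := (mul_pos hδ hβp).trans_le (hd i j)
    have := mul_le_mul_of_nonneg_left (three_mul_sq_le_mul_add_div_add_div (div_pos hbp hαp)
      (div_pos hdp hβp) hC0) (by positivity : 0 ≤ α i * β j * c i j)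
    refine le_of_eq_of_le (mul_comm _ _) (this.trans_eq ?_)
    field_simp
  have hsum := Finset.sum_le_sum fun i (_ : i ∈ Finset.univ) =>
    Finset.sum_le_sum fun j (_ : j ∈ Finset.univ) => hpt i j
  simp only [Finset.sum_add_distrib, ← Finset.mul_sum] at hsum
  rw [← hC, Finset.sum_comm (f := fun i j => β j * (c i j * (α i ^ 2 / b i j)))] at hsum
  simp only [← Finset.mul_sum] at hsum
  have h1 : ∑ j, β j * ∑ i, c i j * (α i ^ 2 / b i j) ≤ 1 := by
    rw [← hβ1]
    exact Finset.sum_le_sum fun j _ => mul_le_of_le_one_right (hβ j) (hb1 j)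
  have h2 : ∑ i, α i * ∑ j, c i j * (β j ^ 2 / d i j) ≤ 1 := by
    rw [← hα1]
    exact Finset.sum_le_sum fun i _ => mul_le_of_le_one_right (hα i) (hd1 i)
  have hC3 : 0 ≤ C ^ 3 := by positivity
  nlinarith [mul_le_mul_of_nonneg_left h1 hC3, mul_le_mul_of_nonneg_left h2 hC3]

section Product

variable {Y₁ Y₂ : Type*} [MeasurableSpace Y₁] [MeasurableSpace Y₂] {ν₁ : Measure Y₁}
  {ν₂ : Measure Y₂} [IsProbabilityMeasure ν₁] [IsProbabilityMeasure ν₂]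

theorem integral_block {ι κ : Type*} [Fintype ι] [Fintype κ] [MeasurableSpace ι]
    [MeasurableSpace κ] [MeasurableSingletonClass ι] [MeasurableSingletonClass κ]
    {u : Y₁ → ι} {v : Y₂ → κ} (hu : Measurable u) (hv : Measurable v) (c : ι → κ → ℝ) :
    ∫ p, c (u p.1) (v p.2) ∂(ν₁.prod ν₂) =
      ∑ i, ∑ j, ν₁.real {x | u x = i} * ν₂.real {y | v y = j} * c i j := by
  have h1 := integral_map (μ := ν₁.prod ν₂) (φ := Prod.map u v) (hu.prodMap hv).aemeasurable
    (f := fun q : ι × κ => c q.1 q.2) Measurable.of_discrete.aestronglyMeasurable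
  have h2 := hu.prodMap hv
  have : IsProbabilityMeasure ((ν₁.prod ν₂).map (Prod.map u v)) :=
    Measure.isProbabilityMeasure_map h2.aemeasurable
  simp only [Prod.map_fst, Prod.map_snd] at h1
  rw [← h1, integral_fintype Integrable.of_finite, Fintype.sum_prod_type]
  refine Finset.sum_congr rfl fun i _ => Finset.sum_congr rfl fun j _ => ?_
  rw [map_measureReal_apply h2 (measurableSet_singleton _), smul_eq_mul, ← measureReal_prod_prod]
  congr 2
  ext p
  simp [Prod.ext_iff]

theorem abs_integral_mul_mul_sub_le {X : Type*} [MeasurableSpace X] {μ : Measure X}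
    [IsFiniteMeasure μ] {f g : X → ℝ} (hf : Measurable f) (hg : Measurable g)
    (hf0 : ∀ p, 0 ≤ f p) (hf1 : ∀ p, f p ≤ 1) (hg0 : ∀ p, 0 ≤ g p) (hg1 : ∀ p, g p ≤ 1)
    {T R : X → X} (hT : MeasurePreserving T μ μ) (hR : MeasurePreserving R μ μ) :
    |∫ p, f p * f (T p) * f (R p) ∂μ - ∫ p, g p * g (T p) * g (R p) ∂μ| ≤
      3 * ∫ p, |f p - g p| ∂μ := by
  have hbdd : ∀ {h : X → ℝ}, Measurable h → (∀ p, 0 ≤ h p) → (∀ p, h p ≤ 1) → Integrable h μ :=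
    fun hm h0 h1 => Integrable.of_bound hm.aestronglyMeasurable 1
      (Filter.Eventually.of_forall fun p => by rw [Real.norm_of_nonneg (h0 p)]; exact h1 p)
  have htriple : ∀ {h : X → ℝ}, Measurable h → (∀ p, 0 ≤ h p) → (∀ p, h p ≤ 1) →
      Integrable (fun p => h p * h (T p) * h (R p)) μ := fun hm h0 h1 =>
    hbdd ((hm.mul (hm.comp hT.measurable)).mul (hm.comp hR.measurable))
      (fun p => mul_nonneg (mul_nonneg (h0 _) (h0 _)) (h0 _))
      (fun p => mul_le_one₀ (mul_le_one₀ (h1 _) (h0 _) (h1 _)) (h0 _) (h1 _))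
  have hd : Integrable (fun p => |f p - g p|) μ := ((hbdd hf hf0 hf1).sub (hbdd hg hg0 hg1)).abs
  have hcomp : ∀ {Q : X → X}, MeasurePreserving Q μ μ →
      ∫ p, |f (Q p) - g (Q p)| ∂μ = ∫ p, |f p - g p| ∂μ := fun {Q} hQ => by
    conv_rhs => rw [← hQ.map_eq]
    exact (integral_map (f := fun p => |f p - g p|) hQ.measurable.aemeasurable
      (hf.sub hg).abs.aestronglyMeasurable).symm
  rw [← integral_sub (htriple hf hf0 hf1) (htriple hg hg0 hg1)]
  calc _ ≤ ∫ p, |f p * f (T p) * f (R p) - g p * g (T p) * g (R p)| ∂μ :=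
        abs_integral_le_integral_abs
    _ ≤ ∫ p, (|f p - g p| + |f (T p) - g (T p)| + |f (R p) - g (R p)|) ∂μ := by
        refine integral_mono ((htriple hf hf0 hf1).sub (htriple hg hg0 hg1)).abs
          ((hd.add (hT.integrable_comp_of_integrable hd)).add
            (hR.integrable_comp_of_integrable hd)) fun p => ?_
        have e : f p * f (T p) * f (R p) - g p * g (T p) * g (R p) =
            (f p - g p) * (f (T p) * f (R p)) + (f (T p) - g (T p)) * (g p * f (R p)) +
              (f (R p) - g (R p)) * (g p * g (T p)) := by ring
        have hw : ∀ x w : ℝ, 0 ≤ w → w ≤ 1 → |x * w| ≤ |x| := fun x w h0 h1 => by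
          rw [abs_mul, abs_of_nonneg h0]
          exact mul_le_of_le_one_right (abs_nonneg x) h1
        dsimp only
        rw [e]
        exact (abs_add_three _ _ _).trans (add_le_add_three
          (hw _ _ (mul_nonneg (hf0 _) (hf0 _)) (mul_le_one₀ (hf1 _) (hf0 _) (hf1 _)))
          (hw _ _ (mul_nonneg (hg0 _) (hf0 _)) (mul_le_one₀ (hg1 _) (hf0 _) (hf1 _)))
          (hw _ _ (mul_nonneg (hg0 _) (hg0 _)) (mul_le_one₀ (hg1 _) (hg0 _) (hg1 _))))
    _ = 3 * ∫ p, |f p - g p| ∂μ := by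
        have hdT : Integrable (fun p => |f (T p) - g (T p)|) μ :=
          hT.integrable_comp_of_integrable hd
        have hdR : Integrable (fun p => |f (R p) - g (R p)|) μ :=
          hR.integrable_comp_of_integrable hd
        have hsum := integral_add (hd.add hdT) hdR
        simp only [Pi.add_apply] at hsum
        rw [hsum, integral_add hd hdT, hcomp hT, hcomp hR]
        ring

open Filter Topology in
/-- The recurrence bound for functions constant on the cells of a finite grid, along the differences
of an arbitrary sequence. -/
theorem eventually_block_correlation_gt {S₁ : Y₁ ≃ᵐ Y₁} {S₂ : Y₂ ≃ᵐ Y₂}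
    (h₁ : MeasurePreserving S₁ ν₁ ν₁) (h₂ : MeasurePreserving S₂ ν₂ ν₂) {m n : ℕ}
    {a : Y₁ → Fin m} {b : Y₂ → Fin n} (ha : Measurable a) (hb : Measurable b)
    {c : Fin m → Fin n → ℝ} {δ : ℝ} (hδ : 0 < δ) (hc : ∀ i j, δ ≤ c i j) (t : ℕ → ℤ)
    (𝒰 : Ultrafilter ℕ) {η : ℝ} (hη : 0 < η) :
    ∀ᶠ z : ℕ × ℕ in (𝒰 : Filter ℕ).curry 𝒰,
      (∫ p, c (a p.1) (b p.2) ∂(ν₁.prod ν₂)) ^ 3 - η <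
        ∫ p, c (a p.1) (b p.2) * c (a ((S₁.toEquiv ^ (t z.2 - t z.1)) p.1)) (b p.2) *
          c (a p.1) (b ((S₂.toEquiv ^ (t z.2 - t z.1)) p.2)) ∂(ν₁.prod ν₂) := by
  obtain ⟨q, hqm, hq0, hq1, hqα, hqlim⟩ := exists_fractional_partition h₁ ha t 𝒰
  obtain ⟨r, hrm, hr0, hr1, hrβ, hrlim⟩ := exists_fractional_partition h₂ hb t 𝒰
  have hQ := fun j => sum_mul_sq_integral_div_le_one hqm hq0 hq1 hδ (c := fun i => c i j)
    fun i => hc i j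
  have hR := fun i => sum_mul_sq_integral_div_le_one hrm hr0 hr1 hδ (c := c i) (hc i)
  simp only [hqα] at hQ
  simp only [hrβ] at hR
  have hα1 : ∑ i, ν₁.real {x | a x = i} = 1 := by
    simpa using (integral_block (ν₁ := ν₁) (ν₂ := ν₂) ha (measurable_const (a := ()))
      fun _ _ => 1).symm
  have hβ1 : ∑ j, ν₂.real {y | b y = j} = 1 := by
    simpa using (integral_block (ν₁ := ν₁) (ν₂ := ν₂) (measurable_const (a := ())) hb
      fun _ _ => 1).symm
  have key := sum_pow_three_le_sum_mul_mul hδ (fun i => measureReal_nonneg)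
    (fun j => measureReal_nonneg) hα1 hβ1 (fun i j => hδ.le.trans (hc i j))
    (fun i j => (hQ j).1 i) (fun i j => (hR i).1 j) (fun j => (hQ j).2) (fun i => (hR i).2)
  rw [← integral_block ha hb] at key
  have hlim : Tendsto (fun z : ℕ × ℕ =>
      ∫ p, c (a p.1) (b p.2) * c (a ((S₁.toEquiv ^ (t z.2 - t z.1)) p.1)) (b p.2) *
          c (a p.1) (b ((S₂.toEquiv ^ (t z.2 - t z.1)) p.2)) ∂(ν₁.prod ν₂))
      ((𝒰 : Filter ℕ).curry 𝒰)
      (𝓝 (∑ i, ∑ j, c i j * (∑ i', (∫ x, q i x * q i' x ∂ν₁) * c i' j) *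
        ∑ j', (∫ y, r j y * r j' y ∂ν₂) * c i j')) := by
    have hform : ∀ z : ℕ × ℕ,
        ∫ p, c (a p.1) (b p.2) * c (a ((S₁.toEquiv ^ (t z.2 - t z.1)) p.1)) (b p.2) *
          c (a p.1) (b ((S₂.toEquiv ^ (t z.2 - t z.1)) p.2)) ∂(ν₁.prod ν₂) =
        ∑ i, ∑ j, c i j *
          (∑ i', ν₁.real {x | a x = i ∧ a ((S₁.toEquiv ^ (t z.2 - t z.1)) x) = i'} * c i' j) *
          ∑ j', ν₂.real {y | b y = j ∧ b ((S₂.toEquiv ^ (t z.2 - t z.1)) y) = j'} * c i j' := by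
      intro z
      have := integral_block (ν₁ := ν₁) (ν₂ := ν₂)
        (ha.prodMk (ha.comp (h₁.zpow (t z.2 - t z.1)).measurable))
        (hb.prodMk (hb.comp (h₂.zpow (t z.2 - t z.1)).measurable))
        (fun i j => c i.1 j.1 * c i.2 j.1 * c i.1 j.2)
      simp only [Function.comp_apply, Fintype.sum_prod_type, Prod.mk.injEq] at this
      rw [this]
      refine Finset.sum_congr rfl fun i _ => ?_
      rw [Finset.sum_comm]
      refine Finset.sum_congr rfl fun j _ => ?_
      rw [mul_assoc, Finset.sum_mul_sum, Finset.mul_sum]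
      refine Finset.sum_congr rfl fun i' _ => ?_
      rw [Finset.mul_sum]
      exact Finset.sum_congr rfl fun j' _ => by ring
    simp only [hform]
    exact tendsto_finsetSum _ fun i _ => tendsto_finsetSum _ fun j _ =>
      (tendsto_const_nhds.mul (tendsto_finsetSum _ fun i' _ =>
        (hqlim i i').mul_const _)).mul (tendsto_finsetSum _ fun j' _ => (hrlim j j').mul_const _)
  exact hlim.eventually_const_lt (by linarith)

end Product

theorem multiple_recurrence_product_system_functional
    {Y₁ Y₂ : Type*} [MeasurableSpace Y₁] [MeasurableSpace Y₂]
    (ν₁ : Measure Y₁) (ν₂ : Measure Y₂)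
    [IsProbabilityMeasure ν₁] [IsProbabilityMeasure ν₂]
    (S₁ : Y₁ ≃ᵐ Y₁) (S₂ : Y₂ ≃ᵐ Y₂)
    (h₁ : MeasurePreserving S₁ ν₁ ν₁) (h₂ : MeasurePreserving S₂ ν₂ ν₂)
    (e₁ : ∀ s : Set Y₁, MeasurableSet s → S₁ ⁻¹' s = s → ν₁ s = 0 ∨ ν₁ s = 1)
    (e₂ : ∀ s : Set Y₂, MeasurableSet s → S₂ ⁻¹' s = s → ν₂ s = 0 ∨ ν₂ s = 1)
    (f : Y₁ × Y₂ → ℝ) (hf : Measurable f)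
    (hf0 : ∀ p, 0 ≤ f p) (hf1 : ∀ p, f p ≤ 1)
    (ε : ℝ) (hε : 0 < ε) :
    Syndetic {n : ℤ |
      ∫ p, f p *
          f (((S₁.prodCongr (MeasurableEquiv.refl Y₂)).toEquiv ^ n) p) *
          f ((((MeasurableEquiv.refl Y₁).prodCongr S₂).toEquiv ^ n) p)
        ∂(ν₁.prod ν₂) >
        (∫ p, f p ∂(ν₁.prod ν₂)) ^ 3 - ε} := by
  refine Syndetic.of_forall_exists_sub_mem fun t => ?_
  set δ := min 1 (ε / 14) with hδdef
  have hδ : 0 < δ := lt_min one_pos (by positivity)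
  have hδε : 14 * δ ≤ ε := by
    have := min_le_right 1 (ε / 14)
    linarith
  obtain ⟨m, n, a, b, c, ha, hb, hcδ, hc1, hfc⟩ :=
    BlockApproximable.exists_block_of_measurable (ν₁ := ν₁) (ν₂ := ν₂) hf hf0 hf1 hδ
      (min_le_left _ _)
  rw [probReal_univ] at hfc
  obtain ⟨l, hl⟩ := (Filter.eventually_curry_iff.1 (eventually_block_correlation_gt h₁ h₂ ha hb hδ
    hcδ t (Filter.hyperfilter ℕ) hδ)).exists
  have hlt : ∀ᶠ k in (Filter.hyperfilter ℕ : Filter ℕ), l < k :=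
    Filter.hyperfilter_le_cofinite (by
      rw [Nat.cofinite_eq_atTop]
      exact Filter.eventually_gt_atTop l)
  obtain ⟨k, hk, hlk⟩ := (hl.and hlt).exists
  refine ⟨l, k, hlk, ?_⟩
  simp only [Set.mem_ofPred_eq, MeasurableEquiv.prodCongr_refl_zpow_apply,
    MeasurableEquiv.refl_prodCongr_zpow_apply]
  set N := t k - t l
  have hg := measurable_block ha hb c
  have hg0 : ∀ p : Y₁ × Y₂, 0 ≤ c (a p.1) (b p.2) := fun p => hδ.le.trans (hcδ _ _)
  have hI := abs_integral_mul_mul_sub_le hf hg hf0 hf1 hg0 (fun p => hc1 _ _)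
    ((h₁.zpow N).prod (MeasurePreserving.id ν₂)) ((MeasurePreserving.id ν₁).prod (h₂.zpow N))
  simp only [Prod.map_apply', id_eq] at hI
  have hbdd : ∀ {h : Y₁ × Y₂ → ℝ}, Measurable h → (∀ p, 0 ≤ h p) → (∀ p, h p ≤ 1) →
      Integrable h (ν₁.prod ν₂) ∧ 0 ≤ ∫ p, h p ∂(ν₁.prod ν₂) ∧ ∫ p, h p ∂(ν₁.prod ν₂) ≤ 1 :=
    fun {h} hm h0 h1 => by
      have hi : Integrable h (ν₁.prod ν₂) := Integrable.of_bound hm.aestronglyMeasurable 1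
        (Filter.Eventually.of_forall fun p => by rw [Real.norm_of_nonneg (h0 p)]; exact h1 p)
      refine ⟨hi, integral_nonneg h0, ?_⟩
      simpa using integral_mono hi (integrable_const 1) h1
  obtain ⟨hfi, hF0, hF1⟩ := hbdd hf hf0 hf1
  obtain ⟨hgi, hG0, hG1⟩ := hbdd hg hg0 fun p => hc1 _ _
  have hFG : ∫ p, f p ∂(ν₁.prod ν₂) - ∫ p, c (a p.1) (b p.2) ∂(ν₁.prod ν₂) ≤ 2 * δ := by
    rw [← integral_sub hfi hgi]
    exact (le_abs_self _).trans (abs_integral_le_integral_abs.trans (hfc.trans (by linarith)))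
  have hI' := (abs_le.1 hI).1
  set F := ∫ p, f p ∂(ν₁.prod ν₂)
  set G := ∫ p, c (a p.1) (b p.2) ∂(ν₁.prod ν₂)
  have hcube : F ^ 3 - G ^ 3 ≤ 6 * δ := by
    have e : F ^ 3 - G ^ 3 = (F - G) * (F ^ 2 + F * G + G ^ 2) := by ring
    have h0 : 0 ≤ F ^ 2 + F * G + G ^ 2 := by positivity
    have h3 : F ^ 2 + F * G + G ^ 2 ≤ 3 := by nlinarith
    rw [e]
    nlinarith [mul_le_mul_of_nonneg_right hFG h0]
  linarith
end
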